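/- arXiv:math/0601317 — 3 statements merged into one kernel-verified Lean document; each statement's English description precedes it below -/
import Mathlib

section
/- Let (W,S) be a finite Coxeter system and A a Q-subalgebra of the Solomon descent algebra Σ(W). Then the Jacobson radical of A equals the intersection of A with the Jacobson radical of Σ(W). -/
open MonoidAlgebra

variable {B W : Type*} [DecidableEq B] [Fintype B] [Group W] [Fintype W] [DecidableEq W]

/-- `x_I`: the sum, in the group algebra `ℚW`, of the minimal length coset
representatives of the standard parabolic subgroup `W_I` in `W`, i.e. the sum of the
`w ∈ W` such that `ws > w` for all `s ∈ I`. -/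
noncomputable def descentBasis {M : CoxeterMatrix B} (cs : CoxeterSystem M W)
    (I : Finset B) : MonoidAlgebra ℚ W :=
  ∑ w : W, if ∀ i ∈ I, cs.length w < cs.length (w * cs.simple i)
    then MonoidAlgebra.single w (1 : ℚ) else 0

/-- `A` is the Solomon descent algebra `Σ(W)` of `(W,S)`: a subalgebra of the group
algebra `ℚW` whose underlying set is the span of the elements `x_I`, `I ⊆ S`.
(By Solomon's theorem this span is indeed closed under multiplication.) -/
def IsDescentAlgebra {M : CoxeterMatrix B} (cs : CoxeterSystem M W)
    (A : Subalgebra ℚ (MonoidAlgebra ℚ W)) : Prop :=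
  (A : Set (MonoidAlgebra ℚ W)) = Submodule.span ℚ (Set.range (descentBasis cs))

namespace DescAux
section alg
open Polynomial

theorem exists_idem {R : Type*} [Ring R] [Algebra ℚ R] [FiniteDimensional ℚ R] (a : R) :
    ∃ c e : R, e = c * a ∧ IsIdempotentElem e ∧ (e = 0 → IsNilpotent a) := by
  obtain ⟨p, hp0, hp⟩ : ∃ p : ℚ[X], p ≠ 0 ∧ aeval a p = 0 :=
    Algebra.IsAlgebraic.isAlgebraic a
  obtain ⟨q, hq, hnd⟩ := exists_eq_pow_rootMultiplicity_mul_and_not_dvd p hp0 0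
  set k := p.rootMultiplicity 0
  simp only [C_0, sub_zero] at hq hnd
  have hc : IsCoprime (X ^ (k + 1) : ℚ[X]) q :=
    IsCoprime.pow_left ((Polynomial.prime_X.irreducible.coprime_iff_not_dvd).2 hnd)
  obtain ⟨u, v, huv⟩ := hc
  have hk : aeval a (X ^ k * q) = 0 := by rw [← hq, hp]
  refine ⟨aeval a (u * X ^ k), aeval a (u * X ^ (k + 1)), ?_, ?_, ?_⟩
  · rw [pow_succ, ← mul_assoc, map_mul _ _ X, aeval_X]
  · have : aeval a (u * X ^ (k + 1)) * aeval a (v * q) = 0 := by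
      rw [← map_mul, show u * X ^ (k + 1) * (v * q) = (u * X * v) * (X ^ k * q) by ring, map_mul, hk,
        mul_zero]
    rw [show v * q = 1 - u * X ^ (k + 1) by rw [← huv]; ring, map_sub, map_one, mul_sub, mul_one,
      sub_eq_zero] at this
    exact this.symm
  · intro h
    refine ⟨k, ?_⟩
    have h1 : aeval a (v * q) = 1 := by
      rw [show v * q = 1 - u * X ^ (k + 1) by rw [← huv]; ring, map_sub, map_one, h, sub_zero]
    have : a ^ k * aeval a (v * q) = 0 := by
      rw [← aeval_X_pow (R := ℚ) a, ← map_mul, show (X ^ k * (v * q) : ℚ[X]) = v * (X ^ k * q) by ring, map_mul, hk,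
        mul_zero]
    rwa [h1, mul_one] at this

theorem mem_jacobson_of_nil {R : Type*} [Ring R] (a : R) (h : ∀ y : R, IsNilpotent (y * a)) :
    a ∈ (⊥ : Ideal R).jacobson := by
  rw [Ideal.mem_jacobson_iff]
  intro y
  obtain ⟨u, hu⟩ := (h y).isUnit_one_add
  refine ⟨(u⁻¹ : Rˣ), ?_⟩
  have : ((u⁻¹ : Rˣ) : R) * (1 + y * a) = 1 := by rw [← hu]; simp
  rw [Ideal.mem_bot, mul_assoc, sub_eq_zero, ← this]
  noncomm_ring

theorem isNilpotent_of_mem_jacobson {R : Type*} [Ring R] [Algebra ℚ R] [FiniteDimensional ℚ R] (a : R)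
    (h : a ∈ (⊥ : Ideal R).jacobson) : IsNilpotent a := by
  have : IsArtinianRing R := IsArtinianRing.of_finite ℚ R
  obtain ⟨n, hn⟩ := IsSemiprimaryRing.isNilpotent (R := R)
  refine ⟨n, ?_⟩
  have : a ∈ Ring.jacobson R := by rwa [← Ideal.jacobson_bot]
  have := Ideal.pow_mem_pow this n
  rw [hn] at this
  simpa using this

variable {W : Type*} [Group W] [Fintype W]

theorem trace_mulLeft [DecidableEq W] (f : MonoidAlgebra ℚ W) :
    LinearMap.trace ℚ _ (LinearMap.mulLeft ℚ f) = Fintype.card W * f.coeff 1 := by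
  rw [LinearMap.trace_eq_matrix_trace ℚ (MonoidAlgebra.basis W ℚ), Matrix.trace]
  have : ∀ w : W, (LinearMap.toMatrix (MonoidAlgebra.basis W ℚ) (MonoidAlgebra.basis W ℚ)
      (LinearMap.mulLeft ℚ f)).diag w = f.coeff 1 := by
    intro w
    rw [Matrix.diag_apply, LinearMap.toMatrix_apply, MonoidAlgebra.basis_apply,
      LinearMap.mulLeft_apply]
    change (f * MonoidAlgebra.single w 1).coeff w = _
    simp
  rw [Finset.sum_congr rfl fun w _ => this w, Finset.sum_const, nsmul_eq_mul, Finset.card_univ]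

theorem nilp_coeff_one (f : MonoidAlgebra ℚ W) (h : IsNilpotent f) : f.coeff 1 = 0 := by
  classical
  have h1 : IsNilpotent (LinearMap.mulLeft ℚ f) := (LinearMap.isNilpotent_mulLeft_iff ℚ f).2 h
  have := (LinearMap.isNilpotent_trace_of_isNilpotent h1).eq_zero
  rw [trace_mulLeft] at this
  simpa using this

theorem idem_coeff_one (f : MonoidAlgebra ℚ W) (h : IsIdempotentElem f) (h1 : f.coeff 1 = 0) : f = 0 := by
  classical
  have hh : IsIdempotentElem (LinearMap.mulLeft ℚ f) := by
    rw [IsIdempotentElem, Module.End.mul_eq_comp, ← LinearMap.mulLeft_mul, h.eq]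
  have := (LinearMap.IsIdempotentElem.trace_eq_zero_iff hh).1 (by rw [trace_mulLeft, h1, mul_zero])
  simpa using LinearMap.congr_fun this 1

theorem main_alg (A : Subalgebra ℚ (MonoidAlgebra ℚ W))
    (hA : ∀ a ∈ A, (a * a : MonoidAlgebra ℚ W).coeff 1 = 0 → ∀ b ∈ A, (b * a : MonoidAlgebra ℚ W).coeff 1 = 0)
    (A' : Subalgebra ℚ A) (a : A') :
    a ∈ (⊥ : Ideal A').jacobson ↔ (a : A) ∈ (⊥ : Ideal A).jacobson := by
  have : FiniteDimensional ℚ (MonoidAlgebra ℚ W) := inferInstance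
  have : FiniteDimensional ℚ A := inferInstance
  have : FiniteDimensional ℚ A' := inferInstance
  constructor
  · intro h
    obtain ⟨n, hn⟩ := isNilpotent_of_mem_jacobson a h
    have hn' : ((a : A) : MonoidAlgebra ℚ W) ^ n = 0 := by
      have := congrArg (fun x : A' => ((x : A) : MonoidAlgebra ℚ W)) hn
      simpa using this
    have hz := hA (a : A) (a : A).2 (nilp_coeff_one _ ((Commute.refl _).isNilpotent_mul_left ⟨n, hn'⟩))
    apply mem_jacobson_of_nil
    intro y
    obtain ⟨c, e, he, hid, hnil⟩ := exists_idem (y * (a : A))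
    apply hnil
    apply Subtype.ext
    apply idem_coeff_one
    · exact congrArg Subtype.val hid
    · rw [he, ← mul_assoc]
      exact hz _ (c * y).2
  · intro h
    apply mem_jacobson_of_nil
    intro y
    obtain ⟨n, hn⟩ := isNilpotent_of_mem_jacobson _ (Ideal.mul_mem_left _ (y : A) h)
    exact ⟨n, Subtype.ext (by simpa using hn)⟩

/-- Count of pairs `(h, u)` with `u ∈ H` and `h u h⁻¹ = w`, divided by `|H|`. -/
noncomputable def pfun (H : Subgroup W) (w : W) : ℚ := 
  (Nat.card {p : W × H // p.1 * p.2 * p.1⁻¹ = w} : ℚ) / Nat.card H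

/-- The action of `H × K` on `W` whose orbits are double cosets. -/
@[reducible] def dact (H K : Subgroup W) : MulAction (H × K) W where
  smul p w := p.1 * w * (p.2 : W)⁻¹
  one_smul w := by change ((1 : H) : W) * w * ((1 : K) : W)⁻¹ = w; simp
  mul_smul p q w := by
    change ((p.1 * q.1 : H) : W) * w * ((p.2 * q.2 : K) : W)⁻¹ =
      p.1 * (q.1 * w * (q.2 : W)⁻¹) * (p.2 : W)⁻¹
    simp [mul_assoc]

theorem count_eq (H K : Subgroup W) (P : W → Prop)
    (hP : ∀ g, ∃ x ∈ H, ∃ y ∈ K, P (x * g * y) ∧ ∀ x' ∈ H, ∀ y' ∈ K, P (x' * g * y') →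
      x' * g * y' = x * g * y) :
    (Nat.card {w // P w} : ℚ) = (∑ w, pfun H w * pfun K w) / Fintype.card W := by
  classical
  let _ := dact H K
  have hsmul : ∀ (p : H × K) (w : W), p • w = p.1 * w * (p.2 : W)⁻¹ := fun _ _ => rfl
  have h1 : Nat.card {w // P w} = Nat.card (Quotient (MulAction.orbitRel (H × K) W)) := by
    refine Nat.card_congr (Equiv.ofBijective (fun w => Quotient.mk'' w.1) ⟨?_, ?_⟩)
    · rintro ⟨v, hv⟩ ⟨w, hw⟩ h
      obtain ⟨⟨x, y⟩, hxy⟩ := Quotient.exact h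
      replace hxy : x * w * (y : W)⁻¹ = v := hxy
      obtain ⟨_, _, _, _, _, hu⟩ := hP w
      apply Subtype.ext
      have e1 := hu 1 (one_mem _) 1 (one_mem _) (by simpa using hw)
      have e2 := hu x x.2 _ (inv_mem y.2) (by rwa [hxy])
      rw [hxy] at e2
      simp only [one_mul, mul_one] at e1
      exact e2.trans e1.symm
    · intro q
      induction q using Quotient.inductionOn' with
      | h g =>
        obtain ⟨x, hx, y, hy, hp, _⟩ := hP g
        refine ⟨⟨_, hp⟩, Quotient.sound ⟨(⟨x, hx⟩, ⟨y⁻¹, inv_mem hy⟩), ?_⟩⟩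
        simp [hsmul]
  have h2 := MulAction.sum_card_fixedBy_eq_card_orbits_mul_card_group (H × K) W
  rw [← Nat.card_eq_fintype_card, ← h1] at h2
  -- count triples
  have h3 : (∑ p : H × K, Fintype.card (MulAction.fixedBy W p)) =
      Nat.card {x : W × H × K // x.1 * x.2.2 * x.1⁻¹ = x.2.1} := by
    rw [← Fintype.card_sigma, ← Nat.card_eq_fintype_card]
    refine Nat.card_congr ⟨fun x => ⟨(x.2.1, x.1.1, x.1.2), ?_⟩, fun x => ⟨x.1.2, x.1.1, ?_⟩,
      fun _ => rfl, fun _ => rfl⟩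
    · have := x.2.2
      rw [MulAction.mem_fixedBy, hsmul, mul_inv_eq_iff_eq_mul] at this
      rw [mul_inv_eq_iff_eq_mul, this]
    · have := x.2
      rw [mul_inv_eq_iff_eq_mul] at this
      rw [MulAction.mem_fixedBy, hsmul, mul_inv_eq_iff_eq_mul, this]
  have h4 : Fintype.card W * Nat.card {x : W × H × K // x.1 * x.2.2 * x.1⁻¹ = x.2.1} =
      ∑ w : W, Nat.card {p : W × H // p.1 * p.2 * p.1⁻¹ = w} *
        Nat.card {p : W × K // p.1 * p.2 * p.1⁻¹ = w} := by
    simp_rw [← Nat.card_prod, Nat.card_eq_fintype_card]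
    rw [← Fintype.card_prod, ← Fintype.card_sigma]
    refine Fintype.card_congr ⟨fun x => ⟨x.1 * x.2.1.2.1 * x.1⁻¹, ⟨(x.1, x.2.1.2.1), rfl⟩,
      ⟨(x.1 * x.2.1.1, x.2.1.2.2), ?_⟩⟩,
      fun x => (x.2.1.1.1, ⟨(x.2.1.1.1⁻¹ * x.2.2.1.1, x.2.1.1.2, x.2.2.1.2), ?_⟩), ?_, ?_⟩
    · have := x.2.2
      rw [← this]; group
    · have h1 := x.2.1.2
      have h2 := x.2.2.2
      replace h2 := h2.trans h1.symm
      have : x.2.1.1.1⁻¹ * x.2.2.1.1 * x.2.2.1.2 * (x.2.1.1.1⁻¹ * x.2.2.1.1)⁻¹ =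
        x.2.1.1.1⁻¹ * (x.2.2.1.1 * x.2.2.1.2 * x.2.2.1.1⁻¹) * x.2.1.1.1 := by group
      change x.2.1.1.1⁻¹ * x.2.2.1.1 * x.2.2.1.2 * (x.2.1.1.1⁻¹ * x.2.2.1.1)⁻¹ = x.2.1.1.2
      rw [this, h2]; group
    · rintro ⟨g, ⟨k, u, v⟩, h⟩
      simp
    · rintro ⟨w, ⟨⟨g, u⟩, rfl⟩, ⟨⟨k, v⟩, h⟩⟩
      simp
  have hW : (Fintype.card W : ℚ) ≠ 0 := by simp
  have hH : (Nat.card H : ℚ) ≠ 0 := by simp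
  have hK : (Nat.card K : ℚ) ≠ 0 := by simp
  rw [h3, Fintype.card_prod, ← Nat.card_eq_fintype_card, ← Nat.card_eq_fintype_card] at h2
  rw [h2] at h4
  have h5 : (Fintype.card W : ℚ) * (Nat.card {w // P w} * (Nat.card H * Nat.card K)) =
      ∑ w : W, (Nat.card {p : W × H // p.1 * p.2 * p.1⁻¹ = w} : ℚ) *
        Nat.card {p : W × K // p.1 * p.2 * p.1⁻¹ = w} := by exact_mod_cast h4
  have h6 : ∑ w, pfun H w * pfun K w = (∑ w : W, (Nat.card {p : W × H // p.1 * p.2 * p.1⁻¹ = w} : ℚ) *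
        Nat.card {p : W × K // p.1 * p.2 * p.1⁻¹ = w}) / (Nat.card H * Nat.card K) := by
    rw [Finset.sum_div]
    exact Finset.sum_congr rfl fun w _ => by rw [pfun, pfun, div_mul_div_comm]
  rw [h6, ← h5]
  field_simp

end alg


section cox
open CoxeterSystem
variable {B W : Type*} [Group W] {M : CoxeterMatrix B}

open Classical in
/-- The action of a simple reflection on `W × ZMod 2`. -/
noncomputable def refl (cs : CoxeterSystem M W) (i : B) : Function.End (W × ZMod 2) :=
  fun p => (cs.simple i * p.1 * cs.simple i, p.2 + if p.1 = cs.simple i then 1 else 0)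

open Classical in
theorem refl_pow (cs : CoxeterSystem M W) (i i' : B) (n : ℕ) (t : W) (z : ZMod 2) :
    ((refl cs i * refl cs i') ^ n) (t, z) =
      ((cs.simple i * cs.simple i') ^ n * t * ((cs.simple i * cs.simple i') ^ n)⁻¹,
        z + ∑ j ∈ Finset.range (2 * n),
          if t = cs.simple i' * (cs.simple i * cs.simple i') ^ j then 1 else 0) := by
  have hs := cs.simple_mul_simple_self i
  have hs' := cs.simple_mul_simple_self i'
  have hi := cs.inv_simple i
  have hi' := cs.inv_simple i'
  set s := cs.simple i with hsdef
  set s' := cs.simple i' with hsdef'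
  have hconj : ∀ k : ℕ, ((s * s') ^ k)⁻¹ * s' = s' * (s * s') ^ k := by
    intro k
    rw [← eq_mul_inv_iff_mul_eq, ← conj_pow, ← inv_pow]
    congr 1
    rw [mul_inv_rev, mul_assoc, mul_inv_cancel_right, hi, hi']
  induction n with
  | zero => simp; rfl
  | succ n ih =>
    rw [pow_succ', show ∀ (f g : Function.End (W × ZMod 2)) x, (f * g) x = f (g x) from fun _ _ _ => rfl, ih]
    rw [show ∀ (f g : Function.End (W × ZMod 2)) x, (f * g) x = f (g x) from fun _ _ _ => rfl]
    simp only [refl, ← hsdef, ← hsdef']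
    have e1 : ((s * s') ^ n * t * ((s * s') ^ n)⁻¹ = s') ↔ t = s' * (s * s') ^ (2 * n) := by
      rw [mul_inv_eq_iff_eq_mul, ← eq_inv_mul_iff_mul_eq, ← mul_assoc, hconj, mul_assoc, ← pow_add,
        two_mul]
    have e2 : (s' * ((s * s') ^ n * t * ((s * s') ^ n)⁻¹) * s' = s) ↔
        t = s' * (s * s') ^ (2 * n + 1) := by
      rw [← eq_mul_inv_iff_mul_eq, ← eq_inv_mul_iff_mul_eq, mul_inv_eq_iff_eq_mul,
        ← eq_inv_mul_iff_mul_eq, hi', ← mul_assoc, ← mul_assoc, hconj, mul_assoc, mul_assoc,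
        ← pow_succ', ← pow_add]
      rw [show n + (n + 1) = 2 * n + 1 by ring]
    rw [show 2 * (n + 1) = 2 * n + 1 + 1 by ring, Finset.sum_range_succ, Finset.sum_range_succ]
    simp only [e1, e2]
    refine Prod.ext ?_ ?_
    · simp only [pow_succ', mul_inv_rev, hi, hi', mul_assoc]
    · simp only [add_assoc]

theorem refl_liftable (cs : CoxeterSystem M W) : M.IsLiftable (refl cs) := by
  classical
  intro i i'
  funext ⟨t, z⟩
  rw [refl_pow, cs.simple_mul_simple_pow, two_mul, Finset.sum_range_add]
  simp only [pow_add, cs.simple_mul_simple_pow, one_mul, ← two_mul]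
  rw [show (2 : ZMod 2) = 0 from rfl]
  simp
  rfl

/-- The reflection cocycle representation. -/
noncomputable def rep (cs : CoxeterSystem M W) : W →* Function.End (W × ZMod 2) :=
  cs.lift ⟨refl cs, refl_liftable cs⟩

open Classical in
theorem rep_word (cs : CoxeterSystem M W) (ω : List B) (t : W) (z : ZMod 2) :
    rep cs (cs.wordProd ω) (t, z) =
      (cs.wordProd ω * t * (cs.wordProd ω)⁻¹, z + ((cs.rightInvSeq ω).count t : ℕ)) := by
  induction ω with
  | nil => simp; rfl
  | cons i ω ih =>
    rw [wordProd_cons, map_mul,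
      show ∀ (f g : Function.End (W × ZMod 2)) x, (f * g) x = f (g x) from fun _ _ _ => rfl, ih]
    rw [rep, cs.lift_apply_simple, rightInvSeq, List.count_cons]
    simp only [refl]
    refine Prod.ext ?_ ?_
    · simp [mul_assoc]
    · have : (cs.wordProd ω * t * (cs.wordProd ω)⁻¹ = cs.simple i) ↔
          ((cs.wordProd ω)⁻¹ * cs.simple i * cs.wordProd ω = t) := by
        rw [mul_inv_eq_iff_eq_mul, mul_assoc, inv_mul_eq_iff_eq_mul, eq_comm]
      simp only [this, beq_iff_eq]
      push_cast
      rw [add_assoc]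

theorem exchange (cs : CoxeterSystem M W) (ω : List B) (i : B)
    (h : cs.length (cs.wordProd ω * cs.simple i) < cs.length (cs.wordProd ω)) :
    ∃ j < ω.length, cs.wordProd ω * cs.simple i = cs.wordProd (ω.eraseIdx j) := by
  classical
  have hmem : cs.simple i ∈ cs.rightInvSeq ω := by
    by_contra hn
    obtain ⟨ω', hω', hw⟩ := cs.exists_isReduced (cs.wordProd ω * cs.simple i)
    have h1 : cs.simple i ∉ cs.rightInvSeq ω' := by
      intro hm
      have := (cs.isRightInversion_of_mem_rightInvSeq hω' hm).2
      rw [← hw, simple_mul_simple_cancel_right] at this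
      omega
    have h2 := rep_word cs ω' (cs.simple i) 0
    rw [List.count_eq_zero_of_not_mem h1, ← hw, map_mul,
      show ∀ (f g : Function.End (W × ZMod 2)) x, (f * g) x = f (g x) from fun _ _ _ => rfl] at h2
    have h3 : rep cs (cs.simple i) (cs.simple i, 0) = (cs.simple i, 1) := by
      rw [rep, cs.lift_apply_simple]; simp [refl]
    rw [h3, rep_word, List.count_eq_zero_of_not_mem hn] at h2
    simpa using congrArg Prod.snd h2
  obtain ⟨j, hj, hje⟩ := List.getElem_of_mem hmem
  refine ⟨j, by simpa using hj, ?_⟩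
  rw [← cs.wordProd_mul_getD_rightInvSeq, List.getD_eq_getElem _ _ hj, hje]

theorem exists_reduced_sublist (cs : CoxeterSystem M W) (ω : List B) :
    ∃ ω' : List B, ω'.Sublist ω ∧ cs.IsReduced ω' ∧ cs.wordProd ω' = cs.wordProd ω := by
  induction ω using List.reverseRecOn with
  | nil => exact ⟨[], List.Sublist.refl _, by simp [CoxeterSystem.IsReduced], rfl⟩
  | append_singleton ω i ih =>
    obtain ⟨ω', hs, hr, hp⟩ := ih
    rcases cs.length_mul_simple (cs.wordProd ω') i with h | h
    · refine ⟨ω' ++ [i], hs.append (List.Sublist.refl _), ?_, ?_⟩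
      · rw [CoxeterSystem.IsReduced, wordProd_append, wordProd_singleton, h, hr.eq]; simp
      · rw [wordProd_append, wordProd_append, hp]
    · obtain ⟨j, hj, he⟩ := exchange cs ω' i (by omega)
      refine ⟨ω'.eraseIdx j, ((List.eraseIdx_sublist _ _).trans hs).trans
        (List.sublist_append_left _ _), ?_, ?_⟩
      · rw [CoxeterSystem.IsReduced, ← he, List.length_eraseIdx_of_lt hj, ← hr.eq]; omega
      · rw [← he, wordProd_append, wordProd_singleton, hp]

/-- Standard parabolic subgroup. -/
def para (cs : CoxeterSystem M W) (I : Finset B) : Subgroup W :=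
  Subgroup.closure (cs.simple '' (I : Set B))

theorem simple_mem_para (cs : CoxeterSystem M W) {I : Finset B} {i : B} (hi : i ∈ I) :
    cs.simple i ∈ para cs I := Subgroup.subset_closure ⟨i, hi, rfl⟩

theorem word_mem_para (cs : CoxeterSystem M W) {I : Finset B} {ω : List B} (h : ∀ i ∈ ω, i ∈ I) :
    cs.wordProd ω ∈ para cs I := by
  induction ω with
  | nil => simp
  | cons i ω ih =>
    rw [wordProd_cons]
    exact mul_mem (simple_mem_para cs (h i (by simp))) (ih fun j hj => h j (by simp [hj]))

theorem exists_word_of_mem_para (cs : CoxeterSystem M W) {I : Finset B} {w : W}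
    (hw : w ∈ para cs I) : ∃ ω : List B, (∀ i ∈ ω, i ∈ I) ∧ cs.wordProd ω = w := by
  induction hw using Subgroup.closure_induction with
  | mem x hx =>
    obtain ⟨i, hi, rfl⟩ := hx
    exact ⟨[i], by simpa using hi, by simp⟩
  | one => exact ⟨[], by simp, by simp⟩
  | mul x y _ _ hx hy =>
    obtain ⟨a, ha, rfl⟩ := hx
    obtain ⟨b, hb, rfl⟩ := hy
    refine ⟨a ++ b, ?_, by rw [wordProd_append]⟩
    intro i hi
    rcases List.mem_append.1 hi with h | h
    exacts [ha i h, hb i h]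
  | inv x _ hx =>
    obtain ⟨a, ha, rfl⟩ := hx
    exact ⟨a.reverse, by simpa using ha, by simp⟩

/-- `w` has no left descents in `I` and no right descents in `J`. -/
def IsMin (cs : CoxeterSystem M W) (I J : Finset B) (w : W) : Prop :=
  (∀ i ∈ I, cs.length w < cs.length (cs.simple i * w)) ∧
    (∀ i ∈ J, cs.length w < cs.length (w * cs.simple i))

theorem eq_of_isMin_aux (cs : CoxeterSystem M W) (I J : Finset B) (w d : W)
    (hw : IsMin cs I J w)
    (hd : ∀ x ∈ para cs I, ∀ y ∈ para cs J, cs.length d ≤ cs.length (x * w * y)) (n : ℕ) :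
    ∀ α β : List B, (∀ i ∈ α, i ∈ I) → (∀ i ∈ β, i ∈ J) → α.length + β.length = n →
      w = cs.wordProd α * d * cs.wordProd β → w = d := by
  induction n using Nat.strong_induction_on with
  | _ n ih =>
  intro α β hα hβ hn he
  obtain ⟨δ, hδ, rfl⟩ := cs.exists_isReduced d
  rw [← wordProd_append, ← wordProd_append] at he
  obtain ⟨ρ, hρs, hρr, hρ⟩ := exists_reduced_sublist cs (α ++ δ ++ β)
  rw [← he] at hρ
  obtain ⟨ρ₁, β', rfl, hs1, hβ'⟩ := List.sublist_append_iff.1 hρs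
  obtain ⟨α', δ', rfl, hα', hδ'⟩ := List.sublist_append_iff.1 hs1
  have hαI : ∀ i ∈ α', i ∈ I := fun i hi => hα i (hα'.subset hi)
  have hβJ : ∀ i ∈ β', i ∈ J := fun i hi => hβ i (hβ'.subset hi)
  have hδe : δ' = δ := by
    apply hδ'.eq_of_length_le
    have := hd _ (inv_mem (word_mem_para cs hαI)) _ (inv_mem (word_mem_para cs hβJ))
    rw [← hρ, wordProd_append, wordProd_append, hδ.eq] at this
    have h2 := cs.length_wordProd_le δ'
    simp only [mul_assoc, mul_inv_cancel, mul_one, inv_mul_cancel_left] at this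
    omega
  subst hδe
  by_cases hlt : α'.length + β'.length < n
  · exact ih _ hlt α' β' hαI hβJ rfl (by rw [← hρ, wordProd_append, wordProd_append])
  have l1 := hα'.length_le
  have l2 := hβ'.length_le
  obtain rfl := hα'.eq_of_length_le (by omega)
  obtain rfl := hβ'.eq_of_length_le (by omega)
  have hlen : cs.length w = α'.length + δ'.length + β'.length := by
    rw [← hρ, hρr.eq]; simp [add_assoc]
  have hαn : α' = [] := by
    rcases α' with _ | ⟨i, α⟩
    · rfl
    · exfalso
      have := hw.1 i (hα i (by simp))
      have h2 := cs.length_wordProd_le (α ++ δ' ++ β')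
      have h3 : cs.simple i * w = cs.wordProd (α ++ δ' ++ β') := by
        rw [he, List.cons_append, List.cons_append, wordProd_cons, simple_mul_simple_cancel_left]
      rw [h3] at this
      simp at h2 hlen this
      omega
  have hβn : β' = [] := by
    rcases List.eq_nil_or_concat β' with h | ⟨β, i, h⟩
    · exact h
    · exfalso
      rw [List.concat_eq_append] at h
      subst h
      have := hw.2 i (hβ i (by simp))
      have h2 := cs.length_wordProd_le (α' ++ δ' ++ β)
      have h3 : w * cs.simple i = cs.wordProd (α' ++ δ' ++ β) := by
        rw [he, ← List.append_assoc, cs.wordProd_append _ [i], wordProd_singleton,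
          simple_mul_simple_cancel_right]
      rw [h3] at this
      simp at h2 hlen this
      omega
  subst hαn hβn
  simpa using he

theorem exists_isMin (cs : CoxeterSystem M W) (I J : Finset B) (g : W) :
    ∃ x ∈ para cs I, ∃ y ∈ para cs J, IsMin cs I J (x * g * y) ∧
      ∀ x' ∈ para cs I, ∀ y' ∈ para cs J, IsMin cs I J (x' * g * y') →
        x' * g * y' = x * g * y := by
  let S : Set W := {w | ∃ x ∈ para cs I, ∃ y ∈ para cs J, w = x * g * y}
  have hS : S.Nonempty := ⟨g, 1, one_mem _, 1, one_mem _, by simp⟩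
  obtain ⟨d, ⟨x, hx, y, hy, rfl⟩, hmin⟩ :=
    (InvImage.wf cs.length Nat.lt_wfRel.wf).has_min S hS
  replace hmin : ∀ x' ∈ para cs I, ∀ y' ∈ para cs J,
      cs.length (x * g * y) ≤ cs.length (x' * g * y') := by
    intro x' hx' y' hy'
    exact not_lt.1 (hmin _ ⟨x', hx', y', hy', rfl⟩)
  refine ⟨x, hx, y, hy, ⟨?_, ?_⟩, ?_⟩
  · intro i hi
    refine lt_of_le_of_ne ?_ (cs.length_simple_mul_ne _ i).symm
    have := hmin _ (mul_mem (simple_mem_para cs hi) hx) y hy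
    simpa only [mul_assoc] using this
  · intro i hi
    refine lt_of_le_of_ne ?_ (cs.length_mul_simple_ne _ i).symm
    have := hmin x hx _ (mul_mem hy (simple_mem_para cs hi))
    simpa only [mul_assoc] using this
  · intro x' hx' y' hy' hm
    obtain ⟨α, hα, hαe⟩ := exists_word_of_mem_para cs (mul_mem hx' (inv_mem hx))
    obtain ⟨β, hβ, hβe⟩ := exists_word_of_mem_para cs (mul_mem (inv_mem hy) hy')
    refine eq_of_isMin_aux cs I J _ (x * g * y) hm ?_ _ α β hα hβ rfl ?_
    · intro a ha b hb
      have := hmin _ (mul_mem ha hx') _ (mul_mem hy' hb)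
      simpa only [mul_assoc] using this
    · rw [hαe, hβe]; group

theorem coeff_one_descent [DecidableEq B] [Fintype B] [Fintype W] [DecidableEq W]
    (cs : CoxeterSystem M W) (I J : Finset B) :
    (descentBasis cs I * descentBasis cs J).coeff 1 =
      (∑ w, pfun (para cs I) w * pfun (para cs J) w) / Fintype.card W := by
  classical
  rw [← count_eq (para cs I) (para cs J) (IsMin cs I J) (exists_isMin cs I J)]
  have key : ∀ v w : W, ((if ∀ i ∈ I, cs.length v < cs.length (v * cs.simple i)
      then MonoidAlgebra.single v (1 : ℚ) else 0) *
      (if ∀ i ∈ J, cs.length w < cs.length (w * cs.simple i)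
      then MonoidAlgebra.single w (1 : ℚ) else 0)).coeff 1 =
      if v = w⁻¹ then (if IsMin cs I J w then (1 : ℚ) else 0) else 0 := by
    intro v w
    by_cases hv : v = w⁻¹
    · subst hv
      have : ∀ i, cs.length (w⁻¹ * cs.simple i) = cs.length (cs.simple i * w) := by
        intro i
        rw [← cs.length_inv, mul_inv_rev, inv_inv, cs.inv_simple]
      have hm : IsMin cs I J w ↔ (∀ i ∈ I, cs.length w < cs.length (cs.simple i * w)) ∧
        (∀ i ∈ J, cs.length w < cs.length (w * cs.simple i)) := Iff.rfl
      simp only [cs.length_inv, this, if_true]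
      split_ifs <;> first
        | (exfalso; tauto)
        | simp [MonoidAlgebra.single_mul_single]
    · have : v * w ≠ 1 := fun h => hv (eq_inv_of_mul_eq_one_left h)
      rw [if_neg hv]
      split_ifs <;> simp [MonoidAlgebra.single_mul_single, this]
  rw [descentBasis, descentBasis, Finset.sum_mul_sum]
  simp only [MonoidAlgebra.coeff_sum, Finsupp.finsetSum_apply, key]
  rw [Finset.sum_comm]
  simp only [Finset.sum_ite_eq', Finset.mem_univ, if_true]
  rw [Finset.sum_boole, Nat.card_eq_fintype_card, Fintype.card_subtype]

theorem coeff_one_comb [DecidableEq B] [Fintype B] [Fintype W] [DecidableEq W]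
    (cs : CoxeterSystem M W) (c d : Finset B → ℚ) :
    ((∑ I, d I • descentBasis cs I) * (∑ J, c J • descentBasis cs J)).coeff 1 =
      (∑ w, (∑ I, d I * pfun (para cs I) w) * (∑ J, c J * pfun (para cs J) w)) /
        Fintype.card W := by
  rw [Finset.sum_mul_sum]
  simp only [MonoidAlgebra.coeff_sum, Finsupp.finsetSum_apply, smul_mul_smul_comm,
    MonoidAlgebra.coeff_smul_apply, coeff_one_descent, smul_eq_mul]
  simp only [Finset.sum_mul_sum]
  conv_rhs => rw [Finset.sum_comm, Finset.sum_div]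
  refine Finset.sum_congr rfl fun I _ => ?_
  rw [Finset.sum_comm, Finset.sum_div]
  refine Finset.sum_congr rfl fun J _ => ?_
  rw [← mul_div_assoc, Finset.mul_sum]
  congr 1
  exact Finset.sum_congr rfl fun w _ => by ring

theorem descent_form [DecidableEq B] [Fintype B] [Fintype W] [DecidableEq W]
    (cs : CoxeterSystem M W) (A : Subalgebra ℚ (MonoidAlgebra ℚ W)) (hA : IsDescentAlgebra cs A) :
    ∀ a ∈ A, (a * a : MonoidAlgebra ℚ W).coeff 1 = 0 →
      ∀ b ∈ A, (b * a : MonoidAlgebra ℚ W).coeff 1 = 0 := by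
  have hmem : ∀ a ∈ A, ∃ c : Finset B → ℚ, ∑ I, c I • descentBasis cs I = a := by
    intro a ha
    have : a ∈ (A : Set (MonoidAlgebra ℚ W)) := ha
    rw [hA] at this
    exact (Submodule.mem_span_range_iff_exists_fun ℚ).1 this
  intro a ha h0 b hb
  obtain ⟨c, rfl⟩ := hmem a ha
  obtain ⟨d, rfl⟩ := hmem b hb
  rw [coeff_one_comb] at h0 ⊢
  have hW : (Fintype.card W : ℚ) ≠ 0 := by simp
  rw [div_eq_zero_iff, or_iff_left hW, Finset.sum_eq_zero_iff_of_nonneg fun _ _ => mul_self_nonneg _] at h0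
  rw [Finset.sum_eq_zero, zero_div]
  intro w hw
  rw [mul_self_eq_zero.1 (h0 w hw), mul_zero]

end cox
end DescAux

set_option synthInstance.maxHeartbeats 1000000 in
set_option maxHeartbeats 1000000 in
/-- If `A` is the descent algebra `Σ(W)` of a finite Coxeter system and `A'` is any
`ℚ`-subalgebra of `A`, then `Rad A' = A' ∩ Rad A`: an element of `A'` lies in the
Jacobson radical of `A'` if and only if, viewed in `A`, it lies in the Jacobson
radical of `A`. -/
theorem radical_subalgebra_of_descentAlgebra {M : CoxeterMatrix B}
    (cs : CoxeterSystem M W) (A : Subalgebra ℚ (MonoidAlgebra ℚ W))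
    (hA : IsDescentAlgebra cs A) (A' : Subalgebra ℚ A) :
    ∀ a : A', a ∈ (⊥ : Ideal A').jacobson ↔ (a : A) ∈ (⊥ : Ideal A).jacobson := by
  exact DescAux.main_alg A (DescAux.descent_form cs A hA) A'
end

section
/- Let (W,S) be a finite Coxeter system with longest element w₀. Then w₀ is central in W if and only if for every J ⊆ S the basis element y_J = Σ_{w : R(w)=J} w is invertible in the descent algebra Σ(W), where R(w) = {s ∈ S : ws > w}. -/
open MonoidAlgebra

variable {B W : Type*} [DecidableEq B] [Fintype B] [Group W] [Fintype W] [DecidableEq W]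

/-- `y_J`: the sum of all `w ∈ W` whose ascent set `R(w) = {s ∈ S : ws > w}` equals `J`. -/
noncomputable def descentYBasis {M : CoxeterMatrix B} (cs : CoxeterSystem M W)
    (J : Finset B) : MonoidAlgebra ℚ W :=
  ∑ w : W, if (∀ i : B, i ∈ J ↔ cs.length w < cs.length (w * cs.simple i))
    then MonoidAlgebra.single w (1 : ℚ) else 0


set_option linter.unusedSectionVars false

namespace DescentAux

/-! ### The simple reflections are distinct (geometric representation) -/

noncomputable def geoForm (M : CoxeterMatrix B) (i : B) : Module.Dual ℝ (B → ℝ) :=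
  ∑ j : B, (-2 * Real.cos (Real.pi / M i j)) • LinearMap.proj j

lemma geoForm_apply (M : CoxeterMatrix B) (i j : B) :
    geoForm M i (Pi.single j 1) = -2 * Real.cos (Real.pi / M i j) := by
  simp [geoForm, Pi.single_apply]

lemma geoForm_self (M : CoxeterMatrix B) (i : B) :
    geoForm M i (Pi.single i 1) = 2 := by
  simp [geoForm_apply]

lemma geo_coeff (m : ℕ) (hm : 3 ≤ m) (t : ℝ)
    (ht : t = 2 * Real.cos (2 * Real.pi / m)) :
    ((Polynomial.Chebyshev.S ℝ (((m : ℤ) - 2) / 2)).eval t *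
      ((Polynomial.Chebyshev.S ℝ (((m : ℤ) - 1) / 2)).eval t +
        (Polynomial.Chebyshev.S ℝ (((m : ℤ) - 3) / 2)).eval t)) = 0 ∧
    ((Polynomial.Chebyshev.S ℝ (((m : ℤ) - 1) / 2)).eval t *
      ((Polynomial.Chebyshev.S ℝ ((m : ℤ) / 2)).eval t +
        (Polynomial.Chebyshev.S ℝ (((m : ℤ) - 2) / 2)).eval t)) = 0 := by
  have hm0 : (0 : ℝ) < m := by positivity
  have hsin : Real.sin (2 * Real.pi / m) ≠ 0 := by
    apply ne_of_gt
    apply Real.sin_pos_of_pos_of_lt_pi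
    · positivity
    · rw [div_lt_iff₀ hm0]
      have : (3 : ℝ) ≤ m := by exact_mod_cast hm
      nlinarith [Real.pi_pos]
  have key := fun n : ℤ => Polynomial.Chebyshev.S_two_mul_real_cos (2 * Real.pi / m) n
  rw [← ht] at key
  rcases Nat.even_or_odd' m with ⟨k, rfl | rfl⟩
  · have e1 : (((2 * k : ℕ) : ℤ) - 2) / 2 = k - 1 := by push_cast; omega
    have e2 : (((2 * k : ℕ) : ℤ) - 1) / 2 = k - 1 := by push_cast; omega
    have h0 : (Polynomial.Chebyshev.S ℝ ((k : ℤ) - 1)).eval t = 0 := by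
      have := key (k - 1)
      have h2 : ((((k : ℤ) - 1 : ℤ) : ℝ) + 1) * (2 * Real.pi / ((2 * k : ℕ) : ℝ)) = Real.pi := by
        push_cast
        have : (k : ℝ) ≠ 0 := by
          intro h; simp [h] at hm0
        field_simp
        ring
      rw [h2, Real.sin_pi] at this
      exact (mul_eq_zero.mp this).resolve_right hsin
    rw [e1, e2, h0]; simp
  · have e1 : (((2 * k + 1 : ℕ) : ℤ) - 2) / 2 = k - 1 := by push_cast; omega
    have e2 : (((2 * k + 1 : ℕ) : ℤ) - 1) / 2 = k := by push_cast; omega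
    have e3 : (((2 * k + 1 : ℕ) : ℤ) - 3) / 2 = k - 1 := by push_cast; omega
    have e4 : (((2 * k + 1 : ℕ) : ℤ)) / 2 = k := by push_cast; omega
    have h0 : (Polynomial.Chebyshev.S ℝ (k : ℤ)).eval t +
        (Polynomial.Chebyshev.S ℝ ((k : ℤ) - 1)).eval t = 0 := by
      have a := key k
      have b := key (k - 1)
      have h2 : Real.sin ((((k : ℤ) : ℝ) + 1) * (2 * Real.pi / ((2 * k + 1 : ℕ) : ℝ))) =
          - Real.sin (((((k : ℤ) - 1 : ℤ) : ℝ) + 1) * (2 * Real.pi / ((2 * k + 1 : ℕ) : ℝ))) := by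
        rw [← Real.sin_neg, ← Real.sin_add_two_pi (-_)]
        congr 1
        push_cast
        have : (2 * (k : ℝ) + 1) ≠ 0 := by positivity
        field_simp
        ring
      have : ((Polynomial.Chebyshev.S ℝ (k : ℤ)).eval t +
        (Polynomial.Chebyshev.S ℝ ((k : ℤ) - 1)).eval t) * Real.sin (2 * Real.pi / ((2 * k + 1 : ℕ) : ℝ)) = 0 := by
        rw [add_mul, a, b, h2]; ring
      exact (mul_eq_zero.mp this).resolve_right hsin
    rw [e1, e2, e3, e4, h0]; simp

lemma geo_liftable (M : CoxeterMatrix B) :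
    M.IsLiftable (fun i => Module.reflection (geoForm_self M i)) := by
  intro i j
  by_cases h0 : M i j = 0
  · simp [h0]
  by_cases hij : i = j
  · subst hij
    simp only [M.diagonal, pow_one]
    ext1 v
    exact Module.involutive_reflection (geoForm_self M i) v
  have h1 : M i j ≠ 1 := M.off_diagonal i j hij
  have hs : M j i = M i j := M.symmetric j i
  ext1 z
  rw [Module.reflection_mul_reflection_pow_apply]
  by_cases h2 : M i j = 2
  · rw [geoForm_apply, geoForm_apply, hs, h2]
    simp
    norm_num
    abel
  have h3 : 3 ≤ M i j := by omega
  obtain ⟨a, b⟩ := geo_coeff (M i j) h3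
    (geoForm M i (Pi.single j 1) * geoForm M j (Pi.single i 1) - 2) (by
      rw [geoForm_apply, geoForm_apply, hs, mul_div_assoc, Real.cos_two_mul]; ring)
  rw [a, b]; simp

lemma simple_inj {M : CoxeterMatrix B} (cs : CoxeterSystem M W) :
    Function.Injective cs.simple := by
  intro i j hij
  by_contra hne
  have h := congrArg (cs.lift ⟨_, geo_liftable M⟩) hij
  rw [cs.lift_apply_simple (geo_liftable M), cs.lift_apply_simple (geo_liftable M)] at h
  have h2 := congrArg (fun e : (B → ℝ) ≃ₗ[ℝ] (B → ℝ) => e (Pi.single i 1) i) h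
  simp only [Module.reflection_apply, geoForm_self] at h2
  simp [hne] at h2

/-! ### The reflection cocycle -/

/-- the action of a simple reflection on `W × ZMod 2` -/
def cocStep {M : CoxeterMatrix B} (cs : CoxeterSystem M W) (i : B) :
    Equiv.Perm (W × ZMod 2) :=
  Function.Involutive.toPerm
    (fun p => (cs.simple i * p.1 * cs.simple i, p.2 + if p.1 = cs.simple i then 1 else 0)) (by
      rintro ⟨t, e⟩
      have h : cs.simple i * t * cs.simple i = cs.simple i ↔ t = cs.simple i := by
        constructor
        · intro h
          have := congrArg (fun x => cs.simple i * x * cs.simple i) h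
          simpa [mul_assoc] using this
        · rintro rfl; simp
      have h2 : ∀ a b : ZMod 2, a + b + b = a := by decide
      simp only [h, h2]
      simp [mul_assoc])

lemma cocStep_apply {M : CoxeterMatrix B} (cs : CoxeterSystem M W) (i : B) (p : W × ZMod 2) :
    cocStep cs i p = (cs.simple i * p.1 * cs.simple i,
      p.2 + if p.1 = cs.simple i then 1 else 0) := rfl

lemma coc_pow {M : CoxeterMatrix B} (cs : CoxeterSystem M W) (i j : B) (n : ℕ) (t : W)
    (e : ZMod 2) :
    ((cocStep cs i * cocStep cs j) ^ n) (t, e) =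
      ((cs.simple i * cs.simple j) ^ n * t * ((cs.simple i * cs.simple j) ^ n)⁻¹,
        e + ∑ l ∈ Finset.range (2 * n),
          if t = ((cs.simple i * cs.simple j) ^ l)⁻¹ * cs.simple j then 1 else 0) := by
  set r := cs.simple i * cs.simple j with hr
  have hrj : ∀ n : ℕ, r ^ n * cs.simple j = cs.simple j * (r ^ n)⁻¹ := by
    intro n
    have h1 : cs.simple j * r * cs.simple j = r⁻¹ := by
      rw [hr]; simp [mul_assoc]
    have h2 : cs.simple j * r ^ n * cs.simple j = (r ^ n)⁻¹ := by
      rw [← inv_pow, ← h1]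
      conv_rhs => rw [show cs.simple j * r * cs.simple j
        = cs.simple j * r * (cs.simple j)⁻¹ by simp]
      rw [conj_pow]; simp
    rw [← h2]; simp [← mul_assoc]
  induction n with
  | zero => simp
  | succ n ih =>
    rw [pow_succ', Equiv.Perm.mul_apply, ih, Equiv.Perm.mul_apply, cocStep_apply, cocStep_apply]
    have c1 : (r ^ n * t * (r ^ n)⁻¹ = cs.simple j) ↔ t = (r ^ (2 * n))⁻¹ * cs.simple j := by
      have : (r ^ (2 * n))⁻¹ * cs.simple j = (r ^ n)⁻¹ * cs.simple j * r ^ n := by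
        have := hrj n
        rw [two_mul, pow_add, mul_inv_rev, mul_assoc, mul_assoc]
        congr 1
        rw [inv_mul_eq_iff_eq_mul, ← mul_assoc, this]; simp
      rw [this]
      constructor
      · intro h; rw [← h]; group
      · intro h; rw [h]; group
    have c2 : (cs.simple j * (r ^ n * t * (r ^ n)⁻¹) * cs.simple j = cs.simple i) ↔
        t = (r ^ (2 * n + 1))⁻¹ * cs.simple j := by
      have : (r ^ (2 * n + 1))⁻¹ * cs.simple j
          = (r ^ n)⁻¹ * (cs.simple j * cs.simple i * cs.simple j) * r ^ n := by
        have h3 : cs.simple j * cs.simple i = r⁻¹ := by rw [hr]; simp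
        rw [h3, show 2 * n + 1 = n + 1 + n by ring, pow_add, pow_succ, mul_inv_rev, mul_inv_rev]
        have h4 : (r ^ n)⁻¹ * cs.simple j = cs.simple j * r ^ n := by
          rw [inv_mul_eq_iff_eq_mul, ← mul_assoc, hrj n]; simp
        have h5 : r⁻¹ * (r ^ n)⁻¹ = (r ^ n)⁻¹ * r⁻¹ := by
          rw [← mul_inv_rev, ← mul_inv_rev, ← pow_succ, ← pow_succ']
        rw [h5]
        simp only [mul_assoc]
        rw [← h4, ← mul_assoc r⁻¹, h5, mul_assoc]
      rw [this]
      constructor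
      · intro h; rw [← h]; simp [mul_assoc]
      · intro h; rw [h]; simp [mul_assoc]
    have c2' := c2
    simp only [c1, c2]
    ext
    · rw [pow_succ' r n, hr]; simp [mul_assoc]
    · simp only
      rw [show 2 * (n + 1) = 2 * n + 1 + 1 by ring, Finset.sum_range_succ, Finset.sum_range_succ]
      ring

lemma coc_liftable {M : CoxeterMatrix B} (cs : CoxeterSystem M W) :
    M.IsLiftable (cocStep cs) := by
  intro i j
  ext1 ⟨t, e⟩
  rw [coc_pow, two_mul, Finset.sum_range_add]
  have h2 : ∀ a b : ZMod 2, a + (b + b) = a := by decide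
  simp only [pow_add, cs.simple_mul_simple_pow, one_mul, h2]
  simp

/-- the reflection cocycle `η(w,t)`: for a reflection `t` it is `1` iff `t` is a left inversion. -/
noncomputable def eta {M : CoxeterMatrix B} (cs : CoxeterSystem M W) (w t : W) : ZMod 2 :=
  (cs.lift ⟨_, coc_liftable cs⟩ w⁻¹ (t, 0)).2

section
variable {M : CoxeterMatrix B} (cs : CoxeterSystem M W)

lemma coc_apply (w t : W) (e : ZMod 2) :
    cs.lift ⟨_, coc_liftable cs⟩ w⁻¹ (t, e) = (w⁻¹ * t * w, e + eta cs w t) := by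
  have main : ∀ w : W, ∀ t : W, ∃ c : ZMod 2, ∀ e,
      cs.lift ⟨_, coc_liftable cs⟩ w (t, e) = (w * t * w⁻¹, e + c) := by
    intro w
    induction w using cs.simple_induction_left with
    | one => intro t; exact ⟨0, by simp⟩
    | mul_simple_left w i ih =>
      intro t
      obtain ⟨c, hc⟩ := ih t
      refine ⟨c + if w * t * w⁻¹ = cs.simple i then 1 else 0, fun e => ?_⟩
      rw [map_mul, Equiv.Perm.mul_apply, hc, cs.lift_apply_simple (coc_liftable cs), cocStep_apply]
      simp [mul_assoc, add_assoc]
  obtain ⟨c, hc⟩ := main w⁻¹ t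
  rw [eta, hc, hc]; simp

lemma eta_mul (u v t : W) : eta cs (u * v) t = eta cs u t + eta cs v (u⁻¹ * t * u) := by
  conv_lhs => rw [eta, mul_inv_rev, map_mul, Equiv.Perm.mul_apply, coc_apply, coc_apply]
  simp

lemma eta_one (t : W) : eta cs 1 t = 0 := by simp [eta]

lemma eta_simple (i : B) (t : W) : eta cs (cs.simple i) t = if t = cs.simple i then 1 else 0 := by
  rw [eta, cs.inv_simple, cs.lift_apply_simple (coc_liftable cs), cocStep_apply]; simp

lemma eta_inv (w t : W) : eta cs w⁻¹ t = eta cs w (w * t * w⁻¹) := by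
  have h := eta_mul cs w w⁻¹ (w * t * w⁻¹)
  rw [mul_inv_cancel, eta_one] at h
  have h2 : w⁻¹ * (w * t * w⁻¹) * w = t := by group
  rw [h2] at h
  have h3 : ∀ a b : ZMod 2, 0 = a + b → b = a := by decide
  exact h3 _ _ h

lemma z2 (a : ZMod 2) : a = 0 ∨ a = 1 := by revert a; decide

lemma exchange (ω : List B) (t : W) (h : eta cs (cs.wordProd ω) t = 1) :
    ∃ k < ω.length, t * cs.wordProd ω = cs.wordProd (ω.eraseIdx k) := by
  induction ω generalizing t with
  | nil => simp [eta_one] at h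
  | cons i ω ih =>
    rw [cs.wordProd_cons, eta_mul, eta_simple] at h
    by_cases ht : t = cs.simple i
    · exact ⟨0, by simp, by simp [ht, cs.wordProd_cons]⟩
    · rw [if_neg ht, zero_add] at h
      obtain ⟨k, hk, hh⟩ := ih _ h
      refine ⟨k + 1, by simpa using hk, ?_⟩
      rw [List.eraseIdx_cons_succ, cs.wordProd_cons, cs.wordProd_cons, ← hh]
      simp [mul_assoc]

lemma length_lt_of_eta (w t : W) (h : eta cs w t = 1) : cs.length (t * w) < cs.length w := by
  obtain ⟨ω, hω, rfl⟩ := cs.exists_isReduced w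
  obtain ⟨k, hk, hh⟩ := exchange cs ω t h
  rw [hh, hω.eq]
  refine lt_of_le_of_lt (cs.length_wordProd_le _) ?_
  rw [List.length_eraseIdx_of_lt hk]; omega

lemma eta_refl (t : W) (ht : cs.IsReflection t) : eta cs t t = 1 := by
  obtain ⟨u, i, rfl⟩ := ht
  rw [eta_mul, eta_mul, eta_inv]
  have h1 : u⁻¹ * (u * cs.simple i * u⁻¹) * u = cs.simple i := by group
  have h2 : (u * cs.simple i)⁻¹ * (u * cs.simple i * u⁻¹) * (u * cs.simple i) = cs.simple i := by
    simp [mul_assoc]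
  rw [h1, h2, eta_simple, if_pos rfl]
  have : ∀ a : ZMod 2, a + 1 + a = 1 := by decide
  exact this _

lemma eta_eq_one_iff (w t : W) (ht : cs.IsReflection t) :
    eta cs w t = 1 ↔ cs.length (t * w) < cs.length w := by
  refine ⟨length_lt_of_eta cs w t, fun h => ?_⟩
  rcases z2 (eta cs w t) with h0 | h0
  · exfalso
    have h1 : eta cs (t * w) t = 1 := by
      rw [eta_mul, eta_refl cs t ht]
      simp [h0]
    have := length_lt_of_eta cs _ _ h1
    rw [← mul_assoc, ht.mul_self, one_mul] at this
    omega
  · exact h0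

lemma asc_iff (w : W) (i : B) :
    cs.length w < cs.length (w * cs.simple i) ↔ eta cs w⁻¹ (cs.simple i) = 0 := by
  have h := eta_eq_one_iff cs w⁻¹ (cs.simple i) (cs.isReflection_simple i)
  rw [← cs.length_inv (cs.simple i * w⁻¹), mul_inv_rev, inv_inv, cs.inv_simple, cs.length_inv] at h
  have h1 := cs.length_mul_simple_ne w i
  rcases z2 (eta cs w⁻¹ (cs.simple i)) with h0 | h0
  · rw [h0] at h ⊢; simp at h ⊢; omega
  · rw [h0] at h ⊢; simp at h ⊢; omega

end

end DescentAux


namespace DescentAux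

section
variable {M : CoxeterMatrix B} (cs : CoxeterSystem M W)

/-- the standard parabolic subgroup `W_K` -/
def par (K : Finset B) : Subgroup W := Subgroup.closure (Set.image cs.simple (K : Set B))

/-- `w` is a minimal coset representative: all `i ∈ K` are right ascents -/
def MinRep (K : Finset B) (w : W) : Prop := ∀ i ∈ K, cs.length w < cs.length (w * cs.simple i)

/-- `w` has no left inversions in `w W_K w⁻¹`. -/
def Good (K : Finset B) (w : W) : Prop :=
  ∀ t, cs.IsReflection t → w⁻¹ * t * w ∈ par cs K → eta cs w t = 0

lemma par_word (K : Finset B) {x : W} (hx : x ∈ par cs K) :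
    ∃ ω : List B, (∀ i ∈ ω, i ∈ K) ∧ x = cs.wordProd ω := by
  induction hx using Subgroup.closure_induction with
  | mem x hx =>
    obtain ⟨i, hi, rfl⟩ := hx
    exact ⟨[i], by simpa using hi, by simp⟩
  | one => exact ⟨[], by simp, by simp⟩
  | mul x y _ _ ihx ihy =>
    obtain ⟨a, ha, rfl⟩ := ihx
    obtain ⟨b, hb, rfl⟩ := ihy
    refine ⟨a ++ b, ?_, by rw [cs.wordProd_append]⟩
    intro i hi
    rcases List.mem_append.mp hi with h | h
    · exact ha i h
    · exact hb i h
  | inv x _ ihx =>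
    obtain ⟨a, ha, rfl⟩ := ihx
    exact ⟨a.reverse, by simpa using ha, by simp⟩

lemma simple_mem (K : Finset B) {i : B} (hi : i ∈ K) : cs.simple i ∈ par cs K :=
  Subgroup.subset_closure ⟨i, hi, rfl⟩

lemma par_desc_aux (K : Finset B) (n : ℕ) : ∀ ω : List B, ω.length ≤ n → (∀ i ∈ ω, i ∈ K) →
    cs.wordProd ω ≠ 1 → ∃ i ∈ K, eta cs (cs.wordProd ω) (cs.simple i) = 1 := by
  induction n with
  | zero =>
    intro ω h _ h1
    have : ω = [] := List.length_eq_zero_iff.mp (by omega)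
    simp [this] at h1
  | succ n ih =>
    intro ω hl hK h1
    match ω, hl, hK, h1 with
    | [], _, _, h1 => simp at h1
    | k :: ω, hl, hK, h1 =>
      rcases z2 (eta cs (cs.wordProd (k :: ω)) (cs.simple k)) with h0 | h0
      · have h2 : eta cs (cs.wordProd ω) (cs.simple k) = 1 := by
          rw [cs.wordProd_cons, eta_mul, eta_simple, if_pos rfl] at h0
          simp only [cs.inv_simple, cs.simple_mul_simple_self, one_mul] at h0
          revert h0
          generalize eta cs (cs.wordProd ω) (cs.simple k) = a
          revert a; decide
        obtain ⟨j, hj, he⟩ := exchange cs ω _ h2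
        rw [← cs.wordProd_cons] at he
        rw [he]
        apply ih
        · rw [List.length_eraseIdx_of_lt hj]
          simp at hl; omega
        · intro i hi
          exact hK i (List.mem_cons_of_mem _ (List.mem_of_mem_eraseIdx hi))
        · rw [← he]; exact h1
      · exact ⟨k, hK k (by simp), h0⟩

lemma par_desc (K : Finset B) {x : W} (hx : x ∈ par cs K) (h1 : x ≠ 1) :
    ∃ i ∈ K, eta cs x (cs.simple i) = 1 := by
  obtain ⟨ω, hω, rfl⟩ := par_word cs K hx
  exact par_desc_aux cs K _ ω le_rfl hω h1

lemma simple_ne_one (i : B) : cs.simple i ≠ 1 := by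
  intro h
  have := cs.length_simple i
  simp [h] at this

lemma simple_mem_iff (K : Finset B) (i : B) : cs.simple i ∈ par cs K ↔ i ∈ K := by
  refine ⟨fun h => ?_, simple_mem cs K⟩
  obtain ⟨k, hk, he⟩ := par_desc cs K h (simple_ne_one cs i)
  rw [eta_simple] at he
  have : cs.simple k = cs.simple i := by
    by_contra hne
    simp [hne] at he
  rwa [← simple_inj cs this]

lemma eta_par (K : Finset B) {x t : W} (hx : x ∈ par cs K) (ht : t ∉ par cs K) :
    eta cs x t = 0 := by
  obtain ⟨ω, hω, rfl⟩ := par_word cs K hx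
  clear hx
  induction ω generalizing t with
  | nil => simp [eta_one]
  | cons i ω ih =>
    have hi : cs.simple i ∈ par cs K := simple_mem cs K (hω i (by simp))
    rw [cs.wordProd_cons, eta_mul, eta_simple, if_neg, zero_add]
    · apply ih
      · intro h
        apply ht
        have := (par cs K).mul_mem ((par cs K).mul_mem hi h) ((par cs K).inv_mem hi)
        simpa [mul_assoc] using this
      · intro j hj; exact hω j (List.mem_cons_of_mem _ hj)
    · rintro rfl; exact ht hi

lemma par_top : par cs Finset.univ = ⊤ := by
  rw [par, Finset.coe_univ, Set.image_univ, cs.subgroup_closure_range_simple]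

lemma exists_desc {x : W} (h1 : x ≠ 1) : ∃ i, eta cs x (cs.simple i) = 1 := by
  obtain ⟨i, _, h⟩ := par_desc cs Finset.univ (x := x) (by rw [par_top]; trivial) h1
  exact ⟨i, h⟩

lemma minRep_iff (K : Finset B) (w : W) :
    MinRep cs K w ↔ ∀ i ∈ K, eta cs w⁻¹ (cs.simple i) = 0 := by
  simp only [MinRep, asc_iff]

lemma good_cancel (K : Finset B) {u v : W} (hu : Good cs K u) (hv : v ∈ par cs K)
    (h : MinRep cs K (u * v)) : v = 1 := by
  by_contra hne
  obtain ⟨i, hi, he⟩ := par_desc cs K ((par cs K).inv_mem hv) (by simpa using hne)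
  have h0 := (minRep_iff cs K _).mp h i hi
  rw [mul_inv_rev, eta_mul, he, eta_inv, hu] at h0
  · simp at h0
  · simpa using cs.isReflection_simple i
  · have := (par cs K).mul_mem ((par cs K).mul_mem hv (simple_mem cs K hi)) ((par cs K).inv_mem hv)
    simpa [mul_assoc] using this

lemma good_minRep (K : Finset B) {w : W} (h : Good cs K w) : MinRep cs K w := by
  rw [minRep_iff]
  intro i hi
  rw [eta_inv]
  apply h
  · exact (cs.isReflection_simple i).conj w
  · have := simple_mem cs K hi
    simpa [mul_assoc] using this

lemma exists_good (K : Finset B) (w : W) : ∃ d, Good cs K d ∧ w⁻¹ * d ∈ par cs K := by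
  classical
  obtain ⟨d, hd, hmin⟩ := Finset.exists_min_image
    (Finset.univ.filter fun d : W => w⁻¹ * d ∈ par cs K) cs.length ⟨w, by simp [one_mem]⟩
  simp only [Finset.mem_filter, Finset.mem_univ, true_and] at hd hmin
  refine ⟨d, ?_, hd⟩
  intro t ht htd
  rcases z2 (eta cs d t) with h | h
  · exact h
  · exfalso
    have h1 := length_lt_of_eta cs _ _ h
    have h2 := hmin (t * d) (by
      have := (par cs K).mul_mem hd htd
      simpa [mul_assoc] using this)
    omega

lemma minRep_good (K : Finset B) {d : W} (hd : MinRep cs K d) : Good cs K d := by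
  obtain ⟨u, hu, hdu⟩ := exists_good cs K d
  have h : u⁻¹ * d ∈ par cs K := by
    have := (par cs K).inv_mem hdu
    simpa using this
  have := good_cancel cs K hu h (by simpa using hd)
  have : d = u := by
    rw [inv_mul_eq_one] at this; exact this.symm
  rwa [this]

lemma minRep_unique (K : Finset B) {d d' : W} (hd : MinRep cs K d) (hd' : MinRep cs K d')
    (h : d⁻¹ * d' ∈ par cs K) : d = d' := by
  have := good_cancel cs K (minRep_good cs K hd) h (by simpa using hd')
  exact inv_mul_eq_one.mp this

/-- the minimal representative of `w W_K` -/
noncomputable def mr (K : Finset B) (w : W) : W := (exists_good cs K w).choose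

lemma mr_good (K : Finset B) (w : W) : Good cs K (mr cs K w) := (exists_good cs K w).choose_spec.1

lemma mr_minRep (K : Finset B) (w : W) : MinRep cs K (mr cs K w) :=
  good_minRep cs K (mr_good cs K w)

lemma mr_mem (K : Finset B) (w : W) : w⁻¹ * mr cs K w ∈ par cs K :=
  (exists_good cs K w).choose_spec.2

lemma mr_mem' (K : Finset B) (w : W) : (mr cs K w)⁻¹ * w ∈ par cs K := by
  have := (par cs K).inv_mem (mr_mem cs K w)
  simpa using this

lemma mr_eq (K : Finset B) {w d : W} (hd : MinRep cs K d) (h : w⁻¹ * d ∈ par cs K) :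
    mr cs K w = d := by
  apply minRep_unique cs K (mr_minRep cs K w) hd
  have := (par cs K).mul_mem (mr_mem' cs K w) h
  simpa [mul_assoc] using this

lemma mr_self (K : Finset B) {d : W} (hd : MinRep cs K d) : mr cs K d = d :=
  mr_eq cs K hd (by simp [one_mem])

lemma mr_mul_mr (K : Finset B) (u w : W) : mr cs K (u * mr cs K w) = mr cs K (u * w) := by
  apply mr_eq cs K (mr_minRep cs K _)
  have := (par cs K).mul_mem (mr_mem' cs K w) (mr_mem cs K (u * w))
  simpa [mul_assoc] using this

lemma eta_mr_in (K : Finset B) (w t : W) (ht : cs.IsReflection t)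
    (h : w⁻¹ * t * w ∈ par cs K) : eta cs (mr cs K w) t = 0 := by
  apply mr_good cs K w t ht
  have := (par cs K).mul_mem ((par cs K).mul_mem (mr_mem' cs K w) h) (mr_mem cs K w)
  simpa [mul_assoc] using this

lemma eta_mr_out (K : Finset B) (w t : W)
    (h : w⁻¹ * t * w ∉ par cs K) : eta cs (mr cs K w) t = eta cs w t := by
  have := eta_mul cs w (w⁻¹ * mr cs K w) t
  rw [eta_par cs K (mr_mem cs K w) h] at this
  simpa using this

/-! ### longest elements -/

lemma exists_lw (K : Finset B) : ∃ x ∈ par cs K, ∀ t, cs.IsReflection t → t ∈ par cs K →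
    eta cs x t = 1 := by
  classical
  obtain ⟨d, hd, hmax⟩ := Finset.exists_max_image
    (Finset.univ.filter fun d : W => d ∈ par cs K) cs.length ⟨1, by simp [one_mem]⟩
  simp only [Finset.mem_filter, Finset.mem_univ, true_and] at hd hmax
  refine ⟨d, hd, fun t ht htK => ?_⟩
  rw [eta_eq_one_iff cs d t ht]
  have h1 := hmax (t * d) ((par cs K).mul_mem htK hd)
  have h2 := ht.length_mul_right_ne d
  omega

noncomputable def lw (K : Finset B) : W := (exists_lw cs K).choose

lemma lw_mem (K : Finset B) : lw cs K ∈ par cs K := (exists_lw cs K).choose_spec.1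

lemma eta_lw_in (K : Finset B) {t : W} (ht : cs.IsReflection t) (h : t ∈ par cs K) :
    eta cs (lw cs K) t = 1 := (exists_lw cs K).choose_spec.2 t ht h

lemma eta_lw_out (K : Finset B) {t : W} (h : t ∉ par cs K) :
    eta cs (lw cs K) t = 0 := eta_par cs K (lw_mem cs K) h

lemma eta_lw_inv_in (K : Finset B) {t : W} (ht : cs.IsReflection t) (h : t ∈ par cs K) :
    eta cs (lw cs K)⁻¹ t = 1 := by
  rw [eta_inv]
  apply eta_lw_in cs K (ht.conj _)
  exact (par cs K).mul_mem ((par cs K).mul_mem (lw_mem cs K) h) ((par cs K).inv_mem (lw_mem cs K))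

lemma eta_lw_inv_out (K : Finset B) {t : W} (h : t ∉ par cs K) :
    eta cs (lw cs K)⁻¹ t = 0 := eta_par cs K ((par cs K).inv_mem (lw_mem cs K)) h

lemma asc_lw (K : Finset B) (i : B) :
    cs.length (lw cs K) < cs.length (lw cs K * cs.simple i) ↔ i ∉ K := by
  rw [asc_iff]
  by_cases h : i ∈ K
  · rw [eta_lw_inv_in cs K (cs.isReflection_simple i) (simple_mem cs K h)]; simp [h]
  · rw [eta_lw_inv_out cs K (by rwa [simple_mem_iff])]; simp [h]

lemma par_mono {L K : Finset B} (h : L ⊆ K) : par cs L ≤ par cs K :=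
  Subgroup.closure_mono (Set.image_mono (by exact_mod_cast h))

end

end DescentAux

namespace DescentAux

section
variable {M : CoxeterMatrix B} (cs : CoxeterSystem M W)

open Classical in
lemma db_eq (I : Finset B) : descentBasis cs I = ∑ d : W, if MinRep cs I d
    then MonoidAlgebra.single d (1 : ℚ) else 0 := by
  unfold descentBasis
  apply Finset.sum_congr rfl
  intro d _
  by_cases h : MinRep cs I d
  · rw [if_pos h]; exact if_pos h
  · rw [if_neg h]; exact if_neg h

open Classical in
lemma db_apply (I : Finset B) (w : W) :
    (descentBasis cs I).coeff w = if MinRep cs I w then (1 : ℚ) else 0 := by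
  rw [db_eq, MonoidAlgebra.coeff_sum, Finsupp.finsetSum_apply, Finset.sum_eq_single w]
  · split_ifs <;> simp
  · intro b _ hb
    split_ifs
    · simp [hb]
    · simp
  · simp

open Classical in
/-- the set counted by a coefficient of `x_I * x_K` -/
noncomputable def cnt (I K : Finset B) (w : W) : Finset W :=
  Finset.univ.filter fun d => MinRep cs I d ∧ MinRep cs K (d⁻¹ * w)

lemma mem_cnt (I K : Finset B) (w d : W) :
    d ∈ cnt cs I K w ↔ MinRep cs I d ∧ MinRep cs K (d⁻¹ * w) := by
  simp [cnt]

lemma mul_db_apply (I K : Finset B) (w : W) :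
    (descentBasis cs I * descentBasis cs K).coeff w = ((cnt cs I K w).card : ℚ) := by
  classical
  rw [db_eq cs I, Finset.sum_mul, MonoidAlgebra.coeff_sum, Finsupp.finsetSum_apply, cnt, Finset.card_filter, Nat.cast_sum]
  apply Finset.sum_congr rfl
  intro d _
  by_cases h1 : MinRep cs I d
  · rw [if_pos h1, MonoidAlgebra.coeff_single_mul_apply, db_apply]
    by_cases h2 : MinRep cs K (d⁻¹ * w) <;> simp [h1, h2]
  · rw [if_neg h1]; simp [h1]

lemma z2_add {a b : ZMod 2} : a + b = 0 ↔ a = b := by revert a b; decide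

lemma crit (K : Finset B) (a w : W) : MinRep cs K (a⁻¹ * w) ↔
    ∀ t, cs.IsReflection t → w⁻¹ * t * w ∈ par cs K → eta cs a t = eta cs w t := by
  constructor
  · intro h t ht htw
    have := minRep_good cs K h (a⁻¹ * t * a) (by simpa using ht.conj a⁻¹)
      (by simpa [mul_assoc] using htw)
    rw [eta_mul, eta_inv, z2_add] at this
    simpa [mul_assoc] using this
  · intro h
    apply good_minRep
    intro t ht htw
    rw [eta_mul, eta_inv, z2_add]
    have := h (a * t * a⁻¹) (ht.conj a) (by simpa [mul_assoc] using htw)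
    simpa [mul_assoc] using this

lemma eta_mr_mul_in (I : Finset B) (u d t : W) (ht : cs.IsReflection t)
    (h : d⁻¹ * (u⁻¹ * t * u) * d ∈ par cs I) : eta cs (mr cs I (u * d)) t = 0 :=
  eta_mr_in cs I _ _ ht (by simpa [mul_assoc] using h)

lemma eta_mr_mul_out (I : Finset B) (u d t : W)
    (h : d⁻¹ * (u⁻¹ * t * u) * d ∉ par cs I) :
    eta cs (mr cs I (u * d)) t = eta cs u t + eta cs d (u⁻¹ * t * u) := by
  rw [eta_mr_out cs I _ _ (by simpa [mul_assoc] using h), eta_mul]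

lemma eta_shift (I : Finset B) (u : W) {d : W} (hd : MinRep cs I d) {t : W}
    (ht : cs.IsReflection t) (hu : eta cs u t = 0) :
    eta cs (mr cs I (u * d)) t = eta cs d (u⁻¹ * t * u) := by
  by_cases h : d⁻¹ * (u⁻¹ * t * u) * d ∈ par cs I
  · rw [eta_mr_mul_in cs I u d t ht h]
    exact (minRep_good cs I hd _ (by simpa using ht.conj u⁻¹) h).symm
  · rw [eta_mr_mul_out cs I u d t h, hu, zero_add]

lemma mr_inv_mul (I : Finset B) (u : W) {d : W} (hd : MinRep cs I d) :
    mr cs I (u⁻¹ * mr cs I (u * d)) = d := by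
  rw [mr_mul_mr, inv_mul_cancel_left, mr_self cs I hd]

lemma mr_mul_inv (I : Finset B) (u : W) {d : W} (hd : MinRep cs I d) :
    mr cs I (u * mr cs I (u⁻¹ * d)) = d := by
  rw [mr_mul_mr, mul_inv_cancel_left, mr_self cs I hd]

lemma conj_mem (K : Finset B) {v t : W} (hv : v ∈ par cs K) :
    v⁻¹ * t * v ∈ par cs K ↔ t ∈ par cs K := by
  constructor
  · intro h
    have := (par cs K).mul_mem ((par cs K).mul_mem hv h) ((par cs K).inv_mem hv)
    simpa [mul_assoc] using this
  · intro h
    exact (par cs K).mul_mem ((par cs K).mul_mem ((par cs K).inv_mem hv) h) hv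

lemma crit_par (K : Finset B) (a : W) {v : W} (hv : v ∈ par cs K) : MinRep cs K (a⁻¹ * v) ↔
    ∀ t, cs.IsReflection t → t ∈ par cs K → eta cs a t = eta cs v t := by
  rw [crit]
  simp only [conj_mem cs K hv]

lemma crit_mul (K : Finset B) (a : W) {u v : W} (hu : MinRep cs K u) (hv : v ∈ par cs K) :
    MinRep cs K (a⁻¹ * (u * v)) ↔
    ∀ t, cs.IsReflection t → t ∈ par cs K → eta cs a (u * t * u⁻¹) = eta cs v t := by
  rw [crit]
  constructor
  · intro h t ht htK
    have h1 : (u * v)⁻¹ * (u * t * u⁻¹) * (u * v) ∈ par cs K := by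
      have := (conj_mem cs K hv (t := t)).mpr htK
      simpa [mul_assoc] using this
    have := h (u * t * u⁻¹) (ht.conj u) h1
    rw [this, eta_mul, minRep_good cs K hu _ (ht.conj u) (by simpa [mul_assoc] using htK), zero_add]
    simp [mul_assoc]
  · intro h t ht htK
    have h1 : u⁻¹ * t * u ∈ par cs K := by
      rw [← conj_mem cs K hv]
      simpa [mul_assoc] using htK
    have := h (u⁻¹ * t * u) (by simpa using ht.conj u⁻¹) h1
    rw [eta_mul, minRep_good cs K hu t ht h1, zero_add, ← this]
    simp [mul_assoc]

lemma card_cnt_mul (I K : Finset B) {u v : W} (hu : MinRep cs K u) (hv : v ∈ par cs K) :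
    (cnt cs I K (u * v)).card = (cnt cs I K v).card := by
  refine Finset.card_bij' (fun d _ => mr cs I (u⁻¹ * d)) (fun d _ => mr cs I (u * d)) ?_ ?_ ?_ ?_
  · intro d hd
    rw [mem_cnt, crit_mul cs K d hu hv] at hd
    rw [mem_cnt, crit_par cs K _ hv]
    refine ⟨mr_minRep cs I _, fun t ht htK => ?_⟩
    rw [eta_shift cs I u⁻¹ hd.1 ht, inv_inv]
    · exact hd.2 t ht htK
    · rw [eta_inv]
      exact minRep_good cs K hu _ (ht.conj u) (by simpa [mul_assoc] using htK)
  · intro d hd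
    rw [mem_cnt, crit_par cs K _ hv] at hd
    rw [mem_cnt, crit_mul cs K _ hu hv]
    refine ⟨mr_minRep cs I _, fun t ht htK => ?_⟩
    rw [eta_shift cs I u hd.1 (ht.conj u)]
    · rw [← hd.2 t ht htK]; simp [mul_assoc]
    · exact minRep_good cs K hu _ (ht.conj u) (by simpa [mul_assoc] using htK)
  · intro d hd
    exact mr_mul_inv cs I u ((mem_cnt cs _ _ _ _).mp hd).1
  · intro d hd
    exact mr_inv_mul cs I u ((mem_cnt cs _ _ _ _).mp hd).1

/-- if `d` has no inversions in `W_K`, avoiding simple reflections is enough -/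
lemma avoid (I K L : Finset B) (hLK : L ⊆ K) {d : W}
    (h0 : ∀ t, cs.IsReflection t → t ∈ par cs K → eta cs d t = 0)
    (hL : ∀ i ∈ L, d⁻¹ * cs.simple i * d ∉ par cs I) {t : W} (ht : cs.IsReflection t)
    (htL : t ∈ par cs L) : d⁻¹ * t * d ∉ par cs I := by
  intro hI
  have ht1 : t ≠ 1 := by
    rintro rfl
    have := eta_refl cs 1 ht
    rw [eta_one] at this
    simp at this
  obtain ⟨i, hi, he⟩ := par_desc cs L htL ht1
  have h1 := eta_mul cs t d (cs.simple i)
  have hs : t⁻¹ * cs.simple i * t ∈ par cs K :=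
    (conj_mem cs K (par_mono cs hLK htL)).mpr (simple_mem cs K (hLK hi))
  rw [he, h0 _ (by simpa using (cs.isReflection_simple i).conj t⁻¹) hs] at h1
  have h2 := eta_mul cs d (d⁻¹ * t * d) (cs.simple i)
  rw [h0 _ (cs.isReflection_simple i) (simple_mem cs K (hLK hi)),
    eta_par cs I hI (hL i hi)] at h2
  have : d * (d⁻¹ * t * d) = t * d := by simp [mul_assoc]
  rw [this, h1] at h2
  simp at h2

open Classical in
/-- elements of `X_I` with no inversion in `W_K` and avoiding `L` -/
noncomputable def avo (I K L : Finset B) : Finset W :=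
  Finset.univ.filter fun d => MinRep cs I d ∧
    (∀ t, cs.IsReflection t → t ∈ par cs K → eta cs d t = 0) ∧
    ∀ i ∈ L, d⁻¹ * cs.simple i * d ∉ par cs I

lemma card_cnt_lw (I K L : Finset B) (hLK : L ⊆ K) :
    (cnt cs I K (lw cs L)).card = (avo cs I K L).card := by
  have hLm := par_mono cs hLK (lw_mem cs L)
  have hcj : ∀ t, t ∈ par cs K → lw cs L * t * (lw cs L)⁻¹ ∈ par cs K := by
    intro t ht
    have := (conj_mem cs K ((par cs K).inv_mem hLm) (t := t)).mpr ht
    simpa using this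
  refine Finset.card_bij' (fun d _ => mr cs I ((lw cs L)⁻¹ * d))
    (fun d _ => mr cs I (lw cs L * d)) ?_ ?_ ?_ ?_
  · intro d hd
    rw [mem_cnt, crit_par cs K d hLm] at hd
    simp only [avo, Finset.mem_filter, Finset.mem_univ, true_and]
    refine ⟨mr_minRep cs I _, ?_, ?_⟩
    · intro t ht htK
      by_cases h : d⁻¹ * ((lw cs L)⁻¹⁻¹ * t * (lw cs L)⁻¹) * d ∈ par cs I
      · exact eta_mr_mul_in cs I _ _ _ ht h
      · rw [eta_mr_mul_out cs I _ _ _ h, eta_inv, z2_add, inv_inv]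
        exact (hd.2 _ (ht.conj _) (hcj t htK)).symm
    · intro i hi hI
      have hc := simple_mem cs L hi
      have hLt : lw cs L * cs.simple i * (lw cs L)⁻¹ ∈ par cs L := by
        have := (conj_mem cs L ((par cs L).inv_mem (lw_mem cs L)) (t := cs.simple i)).mpr hc
        simpa using this
      have hr := (cs.isReflection_simple i).conj (lw cs L)
      have h1 := hd.2 _ hr (par_mono cs hLK hLt)
      rw [eta_lw_in cs L hr hLt] at h1
      have h2 := minRep_good cs I hd.1 _ hr (by
        have hm := mr_mem cs I ((lw cs L)⁻¹ * d)
        have hm' := mr_mem' cs I ((lw cs L)⁻¹ * d)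
        have := (par cs I).mul_mem ((par cs I).mul_mem hm hI) hm'
        simpa [mul_assoc] using this)
      rw [h1] at h2
      simp at h2
  · intro d hd
    simp only [avo, Finset.mem_filter, Finset.mem_univ, true_and] at hd
    obtain ⟨hd1, hd2, hd3⟩ := hd
    rw [mem_cnt, crit_par cs K _ hLm]
    refine ⟨mr_minRep cs I _, fun t ht htK => ?_⟩
    by_cases h : d⁻¹ * ((lw cs L)⁻¹ * t * (lw cs L)) * d ∈ par cs I
    · rw [eta_mr_mul_in cs I _ _ _ ht h]
      by_cases htL : t ∈ par cs L
      · exact absurd h (avoid cs I K L hLK hd2 hd3 (by simpa using ht.conj (lw cs L)⁻¹)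
          ((conj_mem cs L (lw_mem cs L)).mpr htL))
      · exact (eta_lw_out cs L htL).symm
    · rw [eta_mr_mul_out cs I _ _ _ h, hd2 _ (by simpa using ht.conj (lw cs L)⁻¹)
        ((conj_mem cs K hLm).mpr htK), add_zero]
  · intro d hd
    exact mr_mul_inv cs I _ ((mem_cnt cs _ _ _ _).mp hd).1
  · intro d hd
    simp only [avo, Finset.mem_filter, Finset.mem_univ, true_and] at hd
    exact mr_inv_mul cs I _ hd.1

end

end DescentAux

namespace DescentAux

section
variable {M : CoxeterMatrix B} (cs : CoxeterSystem M W)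

lemma altsum (x : Finset B) :
    ∑ L ∈ x.powerset, (-1 : ℚ) ^ L.card = if x = ∅ then 1 else 0 := by
  have := Finset.sum_powerset_neg_one_pow_card (x := x)
  have h2 := congrArg (fun z : ℤ => (z : ℚ)) this
  simpa using h2

lemma altsum_filter (J : Finset B) (p : B → Prop) [DecidablePred p] :
    ∑ L ∈ J.powerset, (-1 : ℚ) ^ L.card * (if ∀ i ∈ L, p i then 1 else 0) =
      if ∀ i ∈ J, ¬ p i then 1 else 0 := by
  have h1 : ∑ L ∈ J.powerset, (-1 : ℚ) ^ L.card * (if ∀ i ∈ L, p i then 1 else 0) =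
      ∑ L ∈ (J.filter p).powerset, (-1 : ℚ) ^ L.card := by
    simp only [mul_ite, mul_one, mul_zero]
    rw [← Finset.sum_filter]
    apply Finset.sum_congr _ fun _ _ => rfl
    ext L
    simp only [Finset.mem_filter, Finset.mem_powerset, Finset.subset_iff]
    constructor
    · rintro ⟨h1, h2⟩ i hi; exact ⟨h1 hi, h2 i hi⟩
    · intro h; exact ⟨fun i hi => (h hi).1, fun i hi => (h hi).2⟩
  rw [h1, altsum]
  simp only [Finset.filter_eq_empty_iff]

/-- the functional `λ_J` -/
noncomputable def lam (J : Finset B) : MonoidAlgebra ℚ W →ₗ[ℚ] ℚ where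
  toFun f := ∑ L ∈ J.powerset, (-1 : ℚ) ^ L.card * f.coeff (lw cs L)
  map_add' f g := by
    simp [mul_add, Finset.sum_add_distrib]
  map_smul' c f := by
    simp only [MonoidAlgebra.coeff_smul_apply, smul_eq_mul, RingHom.id_apply, Finset.mul_sum]
    apply Finset.sum_congr rfl
    intro L _; ring

lemma lam_apply (J : Finset B) (f : MonoidAlgebra ℚ W) :
    lam cs J f = ∑ L ∈ J.powerset, (-1 : ℚ) ^ L.card * f.coeff (lw cs L) := rfl

open Classical in
lemma lam_db (J K : Finset B) : lam cs J (descentBasis cs K) = if J ⊆ K then 1 else 0 := by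
  rw [lam_apply]
  have h : ∀ L ∈ J.powerset, (-1 : ℚ) ^ L.card * (descentBasis cs K).coeff (lw cs L) =
      (-1 : ℚ) ^ L.card * (if ∀ i ∈ L, i ∉ K then 1 else 0) := by
    intro L _
    rw [db_apply]
    congr 2
    simp only [MinRep, asc_lw, eq_iff_iff]
    exact ⟨fun h i hi hk => h i hk hi, fun h i hi hk => h i hk hi⟩
  rw [Finset.sum_congr rfl h, altsum_filter]
  simp [Finset.subset_iff]

lemma conj_par (I K : Finset B) {d : W} (h : ∀ i ∈ K, d⁻¹ * cs.simple i * d ∈ par cs I)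
    {t : W} (ht : t ∈ par cs K) : d⁻¹ * t * d ∈ par cs I := by
  have : par cs K ≤ (par cs I).comap (MulAut.conj d⁻¹).toMonoidHom := by
    rw [par, Subgroup.closure_le]
    rintro _ ⟨i, hi, rfl⟩
    simpa using h i hi
  have := this ht
  simpa using this

open Classical in
/-- the set counted by the mark `χ_K(x_I)` -/
noncomputable def fixs (I K : Finset B) : Finset W :=
  Finset.univ.filter fun d => MinRep cs I d ∧ ∀ i ∈ K, d⁻¹ * cs.simple i * d ∈ par cs I

lemma mem_fixs (I K : Finset B) (d : W) : d ∈ fixs cs I K ↔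
    MinRep cs I d ∧ ∀ i ∈ K, d⁻¹ * cs.simple i * d ∈ par cs I := by
  simp [fixs]

lemma lam_mul_diag (I K : Finset B) :
    lam cs K (descentBasis cs I * descentBasis cs K) = ((fixs cs I K).card : ℚ) := by
  classical
  rw [lam_apply]
  have h : ∀ L ∈ K.powerset, (-1 : ℚ) ^ L.card *
      (descentBasis cs I * descentBasis cs K).coeff (lw cs L) =
      ∑ d : W, (if MinRep cs I d ∧ (∀ t, cs.IsReflection t → t ∈ par cs K → eta cs d t = 0)
        then (-1 : ℚ) ^ L.card * (if ∀ i ∈ L, d⁻¹ * cs.simple i * d ∉ par cs I then 1 else 0)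
        else 0) := by
    intro L hL
    rw [mul_db_apply, card_cnt_lw cs I K L (Finset.mem_powerset.mp hL), avo, Finset.card_filter,
      Nat.cast_sum, Finset.mul_sum]
    apply Finset.sum_congr rfl
    intro d _
    by_cases h1 : MinRep cs I d ∧ (∀ t, cs.IsReflection t → t ∈ par cs K → eta cs d t = 0)
    · rw [if_pos h1]
      congr 1
      by_cases h2 : ∀ i ∈ L, d⁻¹ * cs.simple i * d ∉ par cs I
      · rw [if_pos h2, if_pos ⟨h1.1, h1.2, h2⟩, Nat.cast_one]
      · rw [if_neg h2, if_neg (fun h => h2 h.2.2), Nat.cast_zero]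
    · rw [if_neg h1, if_neg (fun h => h1 ⟨h.1, h.2.1⟩), Nat.cast_zero, mul_zero]
  rw [Finset.sum_congr rfl h, Finset.sum_comm, fixs, Finset.card_filter, Nat.cast_sum]
  apply Finset.sum_congr rfl
  intro d _
  by_cases h1 : MinRep cs I d ∧ (∀ t, cs.IsReflection t → t ∈ par cs K → eta cs d t = 0)
  · simp only [if_pos h1]
    rw [altsum_filter]
    simp [h1.1]
  · simp only [if_neg h1]
    rw [if_neg]
    · simp
    · rintro ⟨h2, h3⟩
      exact h1 ⟨h2, fun t ht htK => minRep_good cs I h2 t ht (conj_par cs I K h3 htK)⟩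

/-- the span of the `x_I` -/
noncomputable def spn : Submodule ℚ (MonoidAlgebra ℚ W) :=
  Submodule.span ℚ (Set.range (descentBasis cs))

lemma db_mem (I : Finset B) : descentBasis cs I ∈ spn cs := Submodule.subset_span ⟨I, rfl⟩

lemma spn_dep {f : MonoidAlgebra ℚ W} (hf : f ∈ spn cs) {w w' : W}
    (h : ∀ i, eta cs w⁻¹ (cs.simple i) = eta cs w'⁻¹ (cs.simple i)) :
    f.coeff w = f.coeff w' := by
  classical
  induction hf using Submodule.span_induction with
  | mem x hx =>
    obtain ⟨I, rfl⟩ := hx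
    rw [db_apply, db_apply]
    congr 1
    simp only [minRep_iff, h]
  | zero => simp
  | add x y _ _ hx hy => simp [hx, hy]
  | smul c x _ hx => simp [hx]

lemma coeff_lw_inter (I K L : Finset B) (hm : descentBasis cs I * descentBasis cs K ∈ spn cs) :
    (descentBasis cs I * descentBasis cs K).coeff (lw cs L) =
    (descentBasis cs I * descentBasis cs K).coeff (lw cs (L ∩ K)) := by
  have hv := mr_mem' cs K (lw cs L)
  have h1 : (descentBasis cs I * descentBasis cs K).coeff (lw cs L) =
      (descentBasis cs I * descentBasis cs K).coeff ((mr cs K (lw cs L))⁻¹ * lw cs L) := by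
    rw [mul_db_apply, mul_db_apply, ← card_cnt_mul cs I K (mr_minRep cs K (lw cs L)) hv,
      mul_inv_cancel_left]
  rw [h1]
  apply spn_dep cs hm
  intro i
  have hr := cs.isReflection_simple i
  by_cases hi : i ∈ K
  · have h2 : eta cs ((mr cs K (lw cs L))⁻¹ * lw cs L)⁻¹ (cs.simple i) =
        eta cs (lw cs L)⁻¹ (cs.simple i) := by
      rw [mul_inv_rev, inv_inv, eta_mul, mr_good cs K (lw cs L), add_zero]
      · simpa using hr
      · have := (conj_mem cs K ((par cs K).inv_mem hv)).mpr (simple_mem cs K hi)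
        simpa [mul_assoc] using this
    rw [h2]
    by_cases hL : i ∈ L
    · rw [eta_lw_inv_in cs L hr (simple_mem cs L hL),
        eta_lw_inv_in cs _ hr (simple_mem cs _ (Finset.mem_inter.mpr ⟨hL, hi⟩))]
    · rw [eta_lw_inv_out cs L (by rwa [simple_mem_iff]),
        eta_lw_inv_out cs _ (by rw [simple_mem_iff]; simp [hL])]
  · rw [eta_par cs K ((par cs K).inv_mem hv) (by rwa [simple_mem_iff]),
      eta_lw_inv_out cs _ (by rw [simple_mem_iff]; simp [hi])]

lemma lam_mul_zero_basis (I J K : Finset B)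
    (hm : descentBasis cs I * descentBasis cs K ∈ spn cs) (hJ : ¬ J ⊆ K) :
    lam cs J (descentBasis cs I * descentBasis cs K) = 0 := by
  rw [lam_apply]
  rw [Finset.sum_congr rfl fun L _ => by rw [coeff_lw_inter cs I K L hm]]
  obtain ⟨s, hs, hsK⟩ := Finset.not_subset.mp hJ
  rw [← Finset.insert_erase hs, Finset.sum_powerset_insert (Finset.notMem_erase s J),
    ← Finset.sum_add_distrib]
  apply Finset.sum_eq_zero
  intro L hL
  have hsL : s ∉ L := fun h => Finset.notMem_erase s J (Finset.mem_powerset.mp hL h)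
  rw [Finset.card_insert_of_notMem hsL, Finset.insert_inter_of_notMem hsK, pow_succ]
  ring

lemma lam_mul_zero (hm : ∀ a ∈ spn cs, ∀ b ∈ spn cs, a * b ∈ spn cs)
    {a : MonoidAlgebra ℚ W} (ha : a ∈ spn cs) (J K : Finset B) (hJ : ¬ J ⊆ K) :
    lam cs J (a * descentBasis cs K) = 0 := by
  induction ha using Submodule.span_induction with
  | mem x hx =>
    obtain ⟨I, rfl⟩ := hx
    exact lam_mul_zero_basis cs I J K (hm _ (db_mem cs I) _ (db_mem cs K)) hJ
  | zero => simp
  | add x y _ _ hx hy => rw [add_mul, map_add, hx, hy, add_zero]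
  | smul c x _ hx => rw [smul_mul_assoc, map_smul, hx, smul_zero]

lemma minRep_univ (w : W) : MinRep cs Finset.univ w ↔ w = 1 := by
  rw [minRep_iff]
  constructor
  · intro h
    by_contra hne
    obtain ⟨i, hi⟩ := exists_desc cs (x := w⁻¹) (by simpa using hne)
    rw [h i (Finset.mem_univ i)] at hi
    simp at hi
  · rintro rfl i _
    rw [inv_one, eta_one]

lemma db_univ : descentBasis cs Finset.univ = 1 := by
  classical
  ext w
  rw [db_apply, MonoidAlgebra.one_def, MonoidAlgebra.coeff_single, Finsupp.single_apply]
  congr 1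
  rw [minRep_univ, eq_iff_iff, eq_comm]

lemma y_apply (J : Finset B) (w : W) : (descentYBasis cs J).coeff w =
    if (∀ i : B, i ∈ J ↔ cs.length w < cs.length (w * cs.simple i)) then (1 : ℚ) else 0 := by
  unfold descentYBasis
  rw [MonoidAlgebra.coeff_sum, Finsupp.finsetSum_apply, Finset.sum_eq_single w]
  · split_ifs <;> simp
  · intro b _ hb
    split_ifs
    · simp [hb]
    · simp
  · simp

lemma y_eq (J : Finset B) : descentYBasis cs J =
    ∑ L ∈ Jᶜ.powerset, (-1 : ℚ) ^ L.card • descentBasis cs (J ∪ L) := by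
  classical
  ext w
  rw [y_apply, MonoidAlgebra.coeff_sum, Finsupp.finsetSum_apply]
  simp only [MonoidAlgebra.coeff_smul_apply, db_apply, smul_eq_mul]
  by_cases h : MinRep cs J w
  · have h1 : ∀ L ∈ Jᶜ.powerset, (-1 : ℚ) ^ L.card * (if MinRep cs (J ∪ L) w then 1 else 0) =
        (-1 : ℚ) ^ L.card *
          (if ∀ i ∈ L, cs.length w < cs.length (w * cs.simple i) then 1 else 0) := by
      intro L _
      congr 2
      simp only [MinRep, Finset.mem_union, eq_iff_iff]
      exact ⟨fun h2 i hi => h2 i (Or.inr hi), fun h2 i hi => hi.elim (h i) (h2 i)⟩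
    rw [Finset.sum_congr rfl h1, altsum_filter]
    congr 1
    simp only [eq_iff_iff, Finset.mem_compl]
    exact ⟨fun h2 i hi hc => hi ((h2 i).mpr hc),
      fun h2 i => ⟨fun hi => h i hi, fun hc => by_contra fun hi => h2 i hi hc⟩⟩
  · rw [if_neg (fun h2 => h fun i hi => (h2 i).mp hi), Finset.sum_eq_zero]
    intro L _
    rw [if_neg, mul_zero]
    exact fun h2 => h fun i hi => h2 i (Finset.mem_union_left _ hi)

lemma y_mem (J : Finset B) : descentYBasis cs J ∈ spn cs := by
  rw [y_eq]
  exact Submodule.sum_mem _ fun L _ => Submodule.smul_mem _ _ (db_mem cs _)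

end

end DescentAux

namespace DescentAux

section
variable {M : CoxeterMatrix B} (cs : CoxeterSystem M W)

lemma eta_longest {w₀ : W} (hw₀ : ∀ w : W, cs.length w ≤ cs.length w₀) {t : W}
    (ht : cs.IsReflection t) : eta cs w₀ t = 1 := by
  rw [eta_eq_one_iff cs w₀ t ht]
  have h1 := hw₀ (t * w₀)
  have h2 := ht.length_mul_right_ne w₀
  omega

lemma conj_simple {w₀ : W} (h0 : ∀ t, cs.IsReflection t → eta cs w₀ t = 1) (i : B) :
    ∃ j, w₀⁻¹ * cs.simple i * w₀ = cs.simple j := by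
  have hr : ∀ r, cs.IsReflection r → r ≠ w₀⁻¹ * cs.simple i * w₀ →
      eta cs (w₀⁻¹ * cs.simple i * w₀) r = 0 := by
    intro r hr hne
    rw [eta_mul, eta_mul, eta_inv, h0 _ (hr.conj w₀), eta_simple, if_neg, h0]
    · decide
    · simpa using hr.conj (w₀⁻¹ * cs.simple i)⁻¹
    · intro h
      apply hne
      rw [← h]; simp [mul_assoc]
  obtain ⟨j, hj⟩ := exists_desc cs (x := w₀⁻¹ * cs.simple i * w₀) (by
    intro h
    apply simple_ne_one cs i
    have : cs.simple i = w₀ * (w₀⁻¹ * cs.simple i * w₀) * w₀⁻¹ := by simp [mul_assoc]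
    rw [this, h]; simp)
  refine ⟨j, ?_⟩
  by_contra hne
  rw [hr _ (cs.isReflection_simple j) (fun h => hne h.symm)] at hj
  simp at hj

lemma full_mul {w₀ : W} (h0 : ∀ t, cs.IsReflection t → eta cs w₀ t = 1) {x : W}
    (hx : ∀ i, eta cs x (cs.simple i) = 1) : w₀ * x = 1 := by
  by_contra hne
  obtain ⟨i, hi⟩ := exists_desc cs hne
  obtain ⟨j, hj⟩ := conj_simple cs h0 i
  rw [eta_mul, h0 _ (cs.isReflection_simple i), hj, hx] at hi
  revert hi; decide

lemma longest_sq {w₀ : W} (h0 : ∀ t, cs.IsReflection t → eta cs w₀ t = 1) : w₀ * w₀ = 1 :=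
  full_mul cs h0 fun i => h0 _ (cs.isReflection_simple i)

lemma full_eq {w₀ : W} (h0 : ∀ t, cs.IsReflection t → eta cs w₀ t = 1) {x : W}
    (hx : ∀ i, eta cs x (cs.simple i) = 1) : x = w₀ :=
  mul_left_cancel ((full_mul cs h0 hx).trans (longest_sq cs h0).symm)

/-! ### the central case -/

lemma fixs_even {w₀ : W} (h0 : ∀ t, cs.IsReflection t → eta cs w₀ t = 1)
    (hc : ∀ w : W, w₀ * w = w * w₀) (I K : Finset B) (hI : I ≠ Finset.univ) :
    ((fixs cs I K).card : ZMod 2) = 0 := by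
  have : ∑ d ∈ fixs cs I K, (1 : ZMod 2) = 0 := by
    refine Finset.sum_involution (fun d _ => mr cs I (w₀ * d)) ?_ ?_ ?_ ?_
    · intro d _; decide
    · intro d hd _ he
      have h1 := mr_mem cs I (w₀ * d)
      have h2 : (w₀ * d)⁻¹ * d = w₀⁻¹ := by rw [hc]; simp
      rw [he, h2, Subgroup.inv_mem_iff] at h1
      apply hI
      rw [Finset.eq_univ_iff_forall]
      intro i
      by_contra hi
      have h3 := eta_par cs I h1 (t := cs.simple i) (by rwa [simple_mem_iff])
      rw [h0 _ (cs.isReflection_simple i)] at h3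
      simp at h3
    · intro d hd
      rw [mem_fixs] at hd ⊢
      refine ⟨mr_minRep cs I _, fun i hi => ?_⟩
      have h1 := mr_mem cs I (w₀ * d)
      have h2 := mr_mem' cs I (w₀ * d)
      have h3 := (par cs I).mul_mem ((par cs I).mul_mem h2 (hd.2 i hi)) h1
      have h4 : (mr cs I (w₀ * d))⁻¹ * (w₀ * d) * (d⁻¹ * cs.simple i * d) *
          ((w₀ * d)⁻¹ * mr cs I (w₀ * d)) =
          (mr cs I (w₀ * d))⁻¹ * (w₀ * cs.simple i) * w₀⁻¹ * mr cs I (w₀ * d) := by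
        group
      rw [h4, hc (cs.simple i)] at h3
      simpa [mul_assoc] using h3
    · intro d hd
      rw [mem_fixs] at hd
      rw [mr_mul_mr, ← mul_assoc, longest_sq cs h0, one_mul, mr_self cs I hd.1]
  simpa using this

lemma fixs_univ (K : Finset B) : fixs cs Finset.univ K = {1} := by
  ext d
  rw [mem_fixs, minRep_univ, par_top]
  simp

lemma chi_y (J K : Finset B) : lam cs K (descentYBasis cs J * descentBasis cs K) =
    ((∑ L ∈ Jᶜ.powerset, (-1 : ℤ) ^ L.card * ((fixs cs (J ∪ L) K).card : ℤ) : ℤ) : ℚ) := by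
  rw [y_eq, Finset.sum_mul, map_sum]
  push_cast
  apply Finset.sum_congr rfl
  intro L _
  rw [smul_mul_assoc, map_smul, lam_mul_diag, smul_eq_mul]

lemma chi_y_ne {w₀ : W} (h0 : ∀ t, cs.IsReflection t → eta cs w₀ t = 1)
    (hc : ∀ w : W, w₀ * w = w * w₀) (J K : Finset B) :
    lam cs K (descentYBasis cs J * descentBasis cs K) ≠ 0 := by
  rw [chi_y]
  intro h
  have h1 := Int.cast_eq_zero.mp h
  have h2 := congrArg (fun z : ℤ => (z : ZMod 2)) h1
  simp only [Int.cast_sum, Int.cast_mul, Int.cast_pow, Int.cast_neg, Int.cast_one,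
    Int.cast_natCast, Int.cast_zero] at h2
  rw [Finset.sum_eq_single Jᶜ] at h2
  · rw [Finset.union_compl, fixs_univ] at h2
    have h3 : (-1 : ZMod 2) = 1 := by decide
    simp [h3] at h2
  · intro L hL hne
    rw [fixs_even cs h0 hc, mul_zero]
    intro hu
    apply hne
    apply Finset.Subset.antisymm (Finset.mem_powerset.mp hL)
    intro i hi
    have : i ∈ J ∪ L := by rw [hu]; exact Finset.mem_univ i
    rcases Finset.mem_union.mp this with h | h
    · exact absurd h (Finset.mem_compl.mp hi)
    · exact h
  · intro h; simp at h

lemma mem_spn {a : MonoidAlgebra ℚ W} (ha : a ∈ spn cs) :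
    ∃ c : Finset B → ℚ, a = ∑ K, c K • descentBasis cs K := by
  obtain ⟨c, hc⟩ := (Submodule.mem_span_range_iff_exists_fun ℚ).mp ha
  exact ⟨c, hc.symm⟩

lemma left_inj (hm : ∀ a ∈ spn cs, ∀ b ∈ spn cs, a * b ∈ spn cs)
    {y : MonoidAlgebra ℚ W} (hy : y ∈ spn cs)
    (hne : ∀ K, lam cs K (y * descentBasis cs K) ≠ 0)
    {a : MonoidAlgebra ℚ W} (ha : a ∈ spn cs) (h : y * a = 0) : a = 0 := by
  classical
  obtain ⟨c, rfl⟩ := mem_spn cs ha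
  have hc : ∀ K, c K = 0 := by
    by_contra hcon
    push Not at hcon
    obtain ⟨K₀, hK₀⟩ := hcon
    obtain ⟨K, hK, hmax⟩ := Finset.exists_max_image
      (Finset.univ.filter fun K : Finset B => c K ≠ 0) Finset.card ⟨K₀, by simp [hK₀]⟩
    simp only [Finset.mem_filter, Finset.mem_univ, true_and] at hK hmax
    have h1 := congrArg (lam cs K) h
    rw [Finset.mul_sum, map_sum, map_zero, Finset.sum_eq_single K] at h1
    · rw [mul_smul_comm, map_smul, smul_eq_mul] at h1
      exact mul_ne_zero hK (hne K) h1
    · intro L _ hL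
      rw [mul_smul_comm, map_smul, smul_eq_mul]
      by_cases h2 : c L = 0
      · rw [h2, zero_mul]
      · rw [lam_mul_zero cs hm hy, mul_zero]
        intro hs
        exact hL (Finset.eq_of_subset_of_card_le hs (hmax L h2)).symm
    · simp
  simp [hc]

lemma central_imp (hm : ∀ a ∈ spn cs, ∀ b ∈ spn cs, a * b ∈ spn cs)
    {w₀ : W} (h0 : ∀ t, cs.IsReflection t → eta cs w₀ t = 1)
    (hc : ∀ w : W, w₀ * w = w * w₀) (J : Finset B) :
    ∃ b ∈ spn cs, descentYBasis cs J * b = 1 ∧ b * descentYBasis cs J = 1 := by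
  have hy := y_mem cs J
  have hinj : ∀ a ∈ spn cs, descentYBasis cs J * a = 0 → a = 0 := fun a ha h =>
    left_inj cs hm hy (chi_y_ne cs h0 hc J) ha h
  have h1 : (1 : MonoidAlgebra ℚ W) ∈ spn cs := by
    rw [← db_univ cs]; exact db_mem cs _
  have : FiniteDimensional ℚ (spn cs) :=
    FiniteDimensional.span_of_finite ℚ (Set.finite_range _)
  let F : spn cs →ₗ[ℚ] spn cs :=
    (LinearMap.mulLeft ℚ (descentYBasis cs J)).restrict (fun a ha => hm _ hy a ha)
  have hF : Function.Injective F := by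
    rw [injective_iff_map_eq_zero]
    intro a ha
    have h2 : descentYBasis cs J * (a : MonoidAlgebra ℚ W) = 0 := congrArg Subtype.val ha
    exact Subtype.ext (hinj a a.2 h2)
  obtain ⟨b, hb⟩ := LinearMap.injective_iff_surjective.mp hF ⟨1, h1⟩
  have hb' : descentYBasis cs J * (b : MonoidAlgebra ℚ W) = 1 := congrArg Subtype.val hb
  refine ⟨b, b.2, hb', ?_⟩
  have h3 := hinj ((b : MonoidAlgebra ℚ W) * descentYBasis cs J - 1)
    ((spn cs).sub_mem (hm _ b.2 _ hy) h1) (by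
      rw [mul_sub, ← mul_assoc, hb', one_mul, mul_one, sub_self])
  exact sub_eq_zero.mp h3

/-! ### the non-central case -/

lemma fixs_self {w₀ : W} (h0 : ∀ t, cs.IsReflection t → eta cs w₀ t = 1) (k : B)
    (hk : w₀ * cs.simple k ≠ cs.simple k * w₀) :
    fixs cs (Finset.univ.erase k) (Finset.univ.erase k) = {1} := by
  set J : Finset B := Finset.univ.erase k with hJ
  have hkJ : k ∉ J := Finset.notMem_erase _ _
  have hJk : ∀ i, i ≠ k → i ∈ J := fun i hi => Finset.mem_erase.mpr ⟨hi, Finset.mem_univ i⟩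
  ext g
  rw [mem_fixs, Finset.mem_singleton]
  constructor
  swap
  · rintro rfl
    refine ⟨?_, fun i hi => by simpa using simple_mem cs J hi⟩
    rw [minRep_iff]
    intro i _
    rw [inv_one, eta_one]
  rintro ⟨hg, hfix⟩
  by_contra hne
  have hgk : eta cs g⁻¹ (cs.simple k) = 1 := by
    obtain ⟨i, hi⟩ := exists_desc cs (x := g⁻¹) (by simpa using hne)
    by_cases hik : i = k
    · rwa [hik] at hi
    · rw [(minRep_iff cs J g).mp hg i (hJk i hik)] at hi
      simp at hi
  have hcon : ∀ t, t ∈ par cs J → g⁻¹ * t * g ∈ par cs J := fun t ht => conj_par cs J J hfix ht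
  have hnorm : g⁻¹ ∈ Subgroup.normalizer (par cs J : Set W) := by
    apply Subgroup.mem_normalizer_fintype
    intro t ht
    simpa using hcon t ht
  have hcon' : ∀ t, t ∈ par cs J → g * t * g⁻¹ ∈ par cs J := by
    intro t ht
    have := (Subgroup.mem_normalizer_iff.mp hnorm (g * t * g⁻¹)).mpr (by simpa [mul_assoc] using ht)
    exact this
  have hx : lw cs J * g⁻¹ = w₀ := by
    apply full_eq cs h0
    intro i
    by_cases hik : i = k
    · subst hik
      have h1 : lw cs J * g⁻¹ = g⁻¹ * (g * lw cs J * g⁻¹) := by simp [mul_assoc]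
      rw [h1, eta_mul, hgk, eta_par cs J (hcon' _ (lw_mem cs J)), add_zero]
      intro h
      have := hcon _ h
      rw [← simple_mem_iff cs] at hkJ
      apply hkJ
      simpa [mul_assoc] using this
    · have hi := simple_mem cs J (hJk i hik)
      have hr := cs.isReflection_simple i
      rw [eta_mul, eta_lw_in cs J hr hi, eta_inv, minRep_good cs J hg, add_zero]
      · simpa using hr.conj (lw cs J)⁻¹
      · have := (conj_mem cs J (lw_mem cs J)).mpr hi
        simpa [mul_assoc] using this
  have hw : ∀ t, t ∈ par cs J → w₀⁻¹ * t * w₀ ∈ par cs J := by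
    intro t ht
    have := hcon' _ ((conj_mem cs J (lw_mem cs J)).mpr ht)
    rw [← hx]
    simpa [mul_assoc] using this
  obtain ⟨j, hj⟩ := conj_simple cs h0 k
  have hinv : w₀⁻¹ = w₀ := inv_eq_of_mul_eq_one_left (longest_sq cs h0)
  by_cases hjk : j = k
  · subst hjk
    apply hk
    calc w₀ * cs.simple j = w₀ * (w₀⁻¹ * cs.simple j * w₀) := by rw [hj]
      _ = cs.simple j * w₀ := by simp [mul_assoc]
  · have h1 := hw _ (simple_mem cs J (hJk j hjk))
    rw [← hj, hinv] at h1
    apply hkJ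
    rw [← simple_mem_iff cs]
    have h2 : w₀ * (w₀ * cs.simple k * w₀) * w₀ = (w₀ * w₀) * cs.simple k * (w₀ * w₀) := by
      simp [mul_assoc]
    rw [h2, longest_sq cs h0] at h1
    simpa using h1

lemma y_erase (k : B) : descentYBasis cs (Finset.univ.erase k) =
    descentBasis cs (Finset.univ.erase k) - 1 := by
  have h1 : (Finset.univ.erase k)ᶜ = insert k (∅ : Finset B) := by
    ext i; simp
  have h2 : Finset.univ.erase k ∪ insert k (∅ : Finset B) = Finset.univ := by
    ext i; simp
  rw [y_eq, h1, Finset.sum_powerset_insert (by simp)]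
  simp only [Finset.powerset_empty, Finset.sum_singleton, Finset.union_empty, h2, db_univ]
  simp [sub_eq_add_neg]

lemma noncentral_imp (hm : ∀ a ∈ spn cs, ∀ b ∈ spn cs, a * b ∈ spn cs)
    {w₀ : W} (h0 : ∀ t, cs.IsReflection t → eta cs w₀ t = 1) (k : B)
    (hk : w₀ * cs.simple k ≠ cs.simple k * w₀) (b : MonoidAlgebra ℚ W) (hb : b ∈ spn cs)
    (hby : b * descentYBasis cs (Finset.univ.erase k) = 1) : False := by
  classical
  have hfix := fixs_self cs h0 k hk
  have hye := y_erase cs k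
  have hy := y_mem cs (Finset.univ.erase k)
  generalize (Finset.univ.erase k : Finset B) = J at *
  have hlJ : lam cs J (descentYBasis cs J * descentBasis cs J) = 0 := by
    rw [hye, sub_mul, map_sub, one_mul, lam_mul_diag, hfix, lam_db]
    simp
  have hl : ∀ L, ¬ L ⊂ J → lam cs L (descentYBasis cs J * descentBasis cs J) = 0 := by
    intro L hL
    by_cases h : L ⊆ J
    · rw [Finset.ssubset_iff_subset_ne] at hL
      have : L = J := by by_contra hne; exact hL ⟨h, hne⟩
      rw [this, hlJ]
    · exact lam_mul_zero cs hm hy L J h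
  obtain ⟨c, hc⟩ := mem_spn cs (hm _ hy _ (db_mem cs J))
  have hc0 : ∀ K, ¬ K ⊂ J → c K = 0 := by
    by_contra hcon
    push Not at hcon
    obtain ⟨K₀, hK₀, hK₀'⟩ := hcon
    obtain ⟨K, hK, hmax⟩ := Finset.exists_max_image
      (Finset.univ.filter fun K : Finset B => ¬ K ⊂ J ∧ c K ≠ 0) Finset.card
      ⟨K₀, by simp only [Finset.mem_filter, Finset.mem_univ, true_and]; exact ⟨hK₀, hK₀'⟩⟩
    simp only [Finset.mem_filter, Finset.mem_univ, true_and] at hK hmax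
    have h1 := hl K hK.1
    rw [hc, map_sum, Finset.sum_eq_single K] at h1
    · rw [map_smul, lam_db, if_pos (Finset.Subset.refl K), smul_eq_mul, mul_one] at h1
      exact hK.2 h1
    · intro L _ hL
      rw [map_smul, lam_db, smul_eq_mul]
      by_cases hs : K ⊆ L
      · by_cases h2 : c L = 0
        · rw [h2, zero_mul]
        · exfalso
          have h3 : ¬ L ⊂ J := fun h => hK.1 (lt_of_le_of_lt hs h)
          exact hL (Finset.eq_of_subset_of_card_le hs (hmax L ⟨h3, h2⟩)).symm
      · rw [if_neg hs, mul_zero]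
    · simp
  have h1 : lam cs J (b * (descentYBasis cs J * descentBasis cs J)) = 1 := by
    rw [← mul_assoc, hby, one_mul, lam_db, if_pos (Finset.Subset.refl J)]
  rw [hc, Finset.mul_sum, map_sum, Finset.sum_eq_zero] at h1
  · simp at h1
  · intro K _
    rw [mul_smul_comm, map_smul, smul_eq_mul]
    by_cases h : K ⊂ J
    · rw [lam_mul_zero cs hm hb J K h.2, mul_zero]
    · rw [hc0 K h, zero_mul]

end

end DescentAux

set_option synthInstance.maxHeartbeats 1000000 in
set_option maxHeartbeats 1000000 in
/-- The longest element `w₀` of `W` is central if and only if every element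
`y_J = Σ_{R(w)=J} w` of the `y`-basis of the descent algebra `Σ(W)` is invertible
in `Σ(W)`. -/
theorem longestElement_central_iff_yBasis_invertible {M : CoxeterMatrix B}
    (cs : CoxeterSystem M W) (A : Subalgebra ℚ (MonoidAlgebra ℚ W))
    (hA : IsDescentAlgebra cs A) (w₀ : W) (hw₀ : ∀ w : W, cs.length w ≤ cs.length w₀) :
    (∀ w : W, w₀ * w = w * w₀) ↔
      ∀ J : Finset B, ∃ b ∈ A,
        descentYBasis cs J * b = 1 ∧ b * descentYBasis cs J = 1 := by
  have hmemA : ∀ a, a ∈ A ↔ a ∈ DescentAux.spn cs := by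
    intro a
    have := Set.ext_iff.mp hA a
    simpa [DescentAux.spn] using this
  have hm : ∀ a ∈ DescentAux.spn cs, ∀ b ∈ DescentAux.spn cs, a * b ∈ DescentAux.spn cs := by
    intro a ha b hb
    rw [← hmemA] at ha hb ⊢
    exact A.mul_mem ha hb
  have h0 : ∀ t, cs.IsReflection t → DescentAux.eta cs w₀ t = 1 :=
    fun t ht => DescentAux.eta_longest cs hw₀ ht
  constructor
  · intro hc J
    obtain ⟨b, hb, h⟩ := DescentAux.central_imp cs hm h0 hc J
    exact ⟨b, (hmemA b).mpr hb, h⟩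
  · intro h
    have hs : ∀ k, w₀ * cs.simple k = cs.simple k * w₀ := by
      intro k
      by_contra hk
      obtain ⟨b, hb, _, hby⟩ := h (Finset.univ.erase k)
      exact DescentAux.noncentral_imp cs hm h0 k hk b ((hmemA b).mp hb) hby
    intro w
    induction w using cs.simple_induction with
    | simple i => exact hs i
    | one => simp
    | mul a b ha hb => rw [← mul_assoc, ha, mul_assoc, hb, mul_assoc]
end

section
/- Let (W,S) be a finite Coxeter system and a ∈ Σ⁺(W) a nonnegative element of the descent algebra. Then aΣ(W) = Σ_{F_eq(a)}(W), where F_eq(a) = {I ⊆ S : ∃ J with ξ_J(a) ≠ 0 and λ(I) ⊆ λ(J)}. In particular Σ(W)a ⊆ aΣ(W). -/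
open MonoidAlgebra

variable {B W : Type*} [DecidableEq B] [Fintype B] [Group W] [Fintype W] [DecidableEq W]

/-- The standard parabolic subgroup `W_I` generated by the simple reflections in `I`. -/
def parabolic {M : CoxeterMatrix B} (cs : CoxeterSystem M W) (I : Finset B) : Subgroup W :=
  Subgroup.closure (cs.simple '' I)

/-- `λ(I) ⊆ λ(J)` in the poset `Λ` of conjugacy classes of parabolic subgroups:
`W_I` is conjugate to a subgroup of `W_J`. -/
def subConj {M : CoxeterMatrix B} (cs : CoxeterSystem M W) (I J : Finset B) : Prop :=
  ∃ w : W, ∀ u ∈ parabolic cs I, w * u * w⁻¹ ∈ parabolic cs J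

section Cocycle

set_option linter.unusedSectionVars false

variable {M : CoxeterMatrix B} (cs : CoxeterSystem M W)

lemma end_mul_apply {X : Type*} (f g : Function.End X) (x : X) : (f * g) x = f (g x) := rfl

lemma end_one_apply {X : Type*} (x : X) : (1 : Function.End X) x = x := rfl

/-- The generator `s_i` acting on `W × ℤ/2`. -/
def sigGen (i : B) : Function.End (W × ZMod 2) :=
  fun p => (cs.simple i * p.1 * cs.simple i, p.2 + if p.1 = cs.simple i then 1 else 0)

lemma sigGen_pow (i j : B) (m : ℕ) (t : W) (e : ZMod 2) :
    ((sigGen cs i * sigGen cs j) ^ m) (t, e) =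
      ((cs.simple i * cs.simple j) ^ m * t * ((cs.simple i * cs.simple j) ^ m)⁻¹,
        e + ∑ k ∈ Finset.range (2 * m),
          if t = cs.simple j * (cs.simple i * cs.simple j) ^ k then 1 else 0) := by
  have hconj : ∀ k : ℕ, ((cs.simple i * cs.simple j) ^ k)⁻¹ * cs.simple j =
      cs.simple j * (cs.simple i * cs.simple j) ^ k := by
    intro k
    induction k with
    | zero => simp
    | succ k ih =>
      rw [pow_succ (cs.simple i * cs.simple j) k, mul_inv_rev, mul_assoc, ih, ← mul_assoc,
        ← pow_succ, pow_succ']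
      simp [mul_assoc]
  induction m with
  | zero => simp [end_one_apply]
  | succ m ih =>
    rw [pow_succ', end_mul_apply, ih]
    have e1 : (cs.simple i * cs.simple j) ^ m * t * ((cs.simple i * cs.simple j) ^ m)⁻¹ =
        cs.simple j ↔ t = cs.simple j * (cs.simple i * cs.simple j) ^ (2 * m) := by
      rw [two_mul, pow_add, ← mul_assoc, ← hconj, mul_inv_eq_iff_eq_mul,
        mul_assoc, eq_inv_mul_iff_mul_eq]
    have e2 : cs.simple j * ((cs.simple i * cs.simple j) ^ m * t *
        ((cs.simple i * cs.simple j) ^ m)⁻¹) * cs.simple j =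
        cs.simple i ↔ t = cs.simple j * (cs.simple i * cs.simple j) ^ (2 * m + 1) := by
      have : cs.simple j * (cs.simple i * cs.simple j) ^ (2 * m + 1) =
        ((cs.simple i * cs.simple j) ^ m)⁻¹ * (cs.simple j * cs.simple i * cs.simple j) *
          (cs.simple i * cs.simple j) ^ m := by
        rw [show 2 * m + 1 = m + 1 + m by ring, pow_add, ← mul_assoc, pow_succ, ← mul_assoc,
          ← hconj]
        simp only [mul_assoc]
      rw [this]
      constructor
      · intro h
        generalize (cs.simple i * cs.simple j) ^ m = g at h ⊢
        rw [← h]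
        simp [mul_assoc]
      · intro h
        rw [h]
        simp [mul_assoc]
    rw [show 2 * (m + 1) = 2 * m + 1 + 1 by ring, Finset.sum_range_succ, Finset.sum_range_succ]
    simp only [sigGen, end_mul_apply, e1, e2]
    refine Prod.ext ?_ ?_
    · simp [pow_succ', mul_assoc]
    · simp [add_assoc]

lemma sigGen_liftable : M.IsLiftable (sigGen cs) := by
  intro i j
  funext ⟨t, e⟩
  rw [sigGen_pow, cs.simple_mul_simple_pow, two_mul, Finset.sum_range_add]
  simp only [pow_add, cs.simple_mul_simple_pow, one_mul, CharTwo.add_self_eq_zero]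
  simp [end_one_apply]

/-- The signed permutation representation. -/
noncomputable def sig : W →* Function.End (W × ZMod 2) := cs.lift ⟨sigGen cs, sigGen_liftable cs⟩

/-- The parity cocycle. -/
noncomputable def eta (w t : W) : ZMod 2 := (sig cs w (t, 0)).2

lemma sig_simple (i : B) : sig cs (cs.simple i) = sigGen cs i :=
  cs.lift_apply_simple (sigGen_liftable cs) i

lemma sig_apply (w t : W) (e : ZMod 2) : sig cs w (t, e) = (w * t * w⁻¹, e + eta cs w t) := by
  induction w using cs.simple_induction_left generalizing t e with
  | one => simp [eta, end_one_apply]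
  | mul_simple_left w i ih =>
    simp only [eta, map_mul, end_mul_apply]
    rw [ih, ih, sig_simple]
    simp [sigGen, mul_assoc, add_assoc]

lemma eta_mul (w d t : W) : eta cs (w * d) t = eta cs d t + eta cs w (d * t * d⁻¹) := by
  conv_lhs => rw [eta, map_mul, end_mul_apply, sig_apply, sig_apply]
  simp

lemma eta_one (t : W) : eta cs 1 t = 0 := by simp [eta, end_one_apply]

lemma eta_simple (i : B) (t : W) : eta cs (cs.simple i) t = if t = cs.simple i then 1 else 0 := by
  simp [eta, sig_simple, sigGen]

lemma eta_inv (w t : W) : eta cs w⁻¹ t = eta cs w (w⁻¹ * t * w) := by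
  have h := eta_mul cs w w⁻¹ t
  rw [mul_inv_cancel, eta_one, inv_inv] at h
  exact CharTwo.add_eq_zero.mp h.symm

lemma mem_ris_of_eta (ω : List B) (t : W) (h : eta cs (cs.wordProd ω) t ≠ 0) :
    t ∈ cs.rightInvSeq ω := by
  induction ω with
  | nil => simp [eta_one] at h
  | cons i ω ih =>
    rw [cs.wordProd_cons, eta_mul, eta_simple] at h
    simp only [CoxeterSystem.rightInvSeq, List.mem_cons]
    by_cases h1 : eta cs (cs.wordProd ω) t = 0
    · left
      have : cs.wordProd ω * t * (cs.wordProd ω)⁻¹ = cs.simple i := by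
        by_contra h2
        simp [h1, h2] at h
      rw [← this]; simp [mul_assoc]
    · exact Or.inr (ih h1)

lemma erase_of_eta (ω : List B) (t : W) (h : eta cs (cs.wordProd ω) t ≠ 0) :
    ∃ k < ω.length, cs.wordProd ω * t = cs.wordProd (ω.eraseIdx k) := by
  obtain ⟨k, hk, rfl⟩ := List.getElem_of_mem (mem_ris_of_eta cs ω t h)
  refine ⟨k, by simpa using hk, ?_⟩
  rw [← cs.wordProd_mul_getD_rightInvSeq, List.getD_eq_getElem _ _ hk]

lemma eta_self {t : W} (ht : cs.IsReflection t) : eta cs t t = 1 := by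
  obtain ⟨u, i, rfl⟩ := ht
  rw [eta_mul, eta_mul, eta_inv, eta_simple]
  have h1 : u⁻¹ * (u * cs.simple i * u⁻¹) * u = cs.simple i := by simp [mul_assoc]
  have h2 : u⁻¹ * (u * cs.simple i * u⁻¹) * u⁻¹⁻¹ = cs.simple i := by simp [mul_assoc]
  rw [h1, h2]
  simp only [if_true]
  have : cs.simple i * cs.simple i * (cs.simple i)⁻¹ = cs.simple i := by simp
  rw [this]
  rw [add_comm (1 : ZMod 2), ← add_assoc, CharTwo.add_self_eq_zero, zero_add]

lemma length_lt_of_eta {w t : W} (h : eta cs w t ≠ 0) : cs.length (w * t) < cs.length w := by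
  obtain ⟨ω, hω, rfl⟩ := cs.exists_isReduced w
  exact (cs.isRightInversion_of_mem_rightInvSeq hω (mem_ris_of_eta cs ω t h)).2

lemma eta_eq_zero_iff {w t : W} (ht : cs.IsReflection t) :
    eta cs w t = 0 ↔ cs.length w < cs.length (w * t) := by
  constructor
  · intro h
    have h1 : eta cs (w * t) t ≠ 0 := by
      rw [eta_mul, eta_self cs ht, show t * t * t⁻¹ = t by simp, h]
      simp
    have := length_lt_of_eta cs h1
    rwa [mul_assoc, ht.mul_self, mul_one] at this
  · intro h
    by_contra h1
    have := length_lt_of_eta cs h1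
    omega

/-- The property `w ∈ X_J`. -/
def InX (J : Finset B) (w : W) : Prop := ∀ i ∈ J, cs.length w < cs.length (w * cs.simple i)

lemma inX_iff {J : Finset B} {w : W} : InX cs J w ↔ ∀ i ∈ J, eta cs w (cs.simple i) = 0 := by
  simp only [InX, eta_eq_zero_iff cs (cs.isReflection_simple _)]

lemma simple_mem_parabolic {J : Finset B} {i : B} (hi : i ∈ J) :
    cs.simple i ∈ parabolic cs J :=
  Subgroup.subset_closure ⟨i, by simpa using hi, rfl⟩

lemma mem_parabolic_of_eta {J : Finset B} {p : W} (hp : p ∈ parabolic cs J) (t : W)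
    (h : eta cs p t ≠ 0) : t ∈ parabolic cs J := by
  induction hp using Subgroup.closure_induction generalizing t with
  | mem x hx =>
    obtain ⟨i, hi, rfl⟩ := hx
    rw [eta_simple] at h
    have : t = cs.simple i := by
      by_contra h2
      simp [h2] at h
    rw [this]
    exact simple_mem_parabolic cs (by simpa using hi)
  | one => simp [eta_one] at h
  | mul x y hx hy ihx ihy =>
    rw [eta_mul] at h
    by_cases h1 : eta cs y t = 0
    · rw [h1, zero_add] at h
      have h2 := ihx _ h
      have h3 := (parabolic cs J).mul_mem ((parabolic cs J).mul_mem
        ((parabolic cs J).inv_mem hy) h2) hy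
      simpa [mul_assoc] using h3
    · exact ihy _ h1
  | inv x hx ih =>
    rw [eta_inv] at h
    have h2 := ih _ h
    have h3 := (parabolic cs J).mul_mem ((parabolic cs J).mul_mem hx h2)
      ((parabolic cs J).inv_mem hx)
    simpa [mul_assoc] using h3

lemma exists_word_of_mem {J : Finset B} {p : W} (hp : p ∈ parabolic cs J) :
    ∃ ω : List B, (∀ i ∈ ω, i ∈ J) ∧ cs.wordProd ω = p := by
  induction hp using Subgroup.closure_induction with
  | mem x hx =>
    obtain ⟨i, hi, rfl⟩ := hx
    exact ⟨[i], by simpa using hi, by simp⟩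
  | one => exact ⟨[], by simp, by simp⟩
  | mul x y hx hy ihx ihy =>
    obtain ⟨a, ha, rfl⟩ := ihx
    obtain ⟨b, hb, rfl⟩ := ihy
    refine ⟨a ++ b, ?_, cs.wordProd_append a b⟩
    intro i hi
    rcases List.mem_append.mp hi with h | h
    · exact ha i h
    · exact hb i h
  | inv x hx ih =>
    obtain ⟨a, ha, rfl⟩ := ih
    exact ⟨a.reverse, fun i hi => ha i (by simpa using hi), cs.wordProd_reverse a⟩

lemma exists_descent {J : Finset B} {q : W} (hq : q ∈ parabolic cs J) (hq1 : q ≠ 1) :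
    ∃ j ∈ J, eta cs q (cs.simple j) ≠ 0 := by
  classical
  have hex : ∃ n, ∃ ω : List B, (∀ i ∈ ω, i ∈ J) ∧ cs.wordProd ω = q ∧ ω.length = n := by
    obtain ⟨ω, h1, h2⟩ := exists_word_of_mem cs hq
    exact ⟨_, ω, h1, h2, rfl⟩
  obtain ⟨ω, h1, h2, h3⟩ := Nat.find_spec hex
  have hmin : ∀ ω' : List B, (∀ i ∈ ω', i ∈ J) → cs.wordProd ω' = q → ω.length ≤ ω'.length := by
    intro ω' h1' h2'
    rw [h3]
    exact Nat.find_min' hex ⟨ω', h1', h2', rfl⟩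
  rcases List.eq_nil_or_concat ω with rfl | ⟨ω', j, rfl⟩
  · exact absurd (by simpa using h2.symm) hq1
  rw [cs.wordProd_concat] at h2
  refine ⟨j, h1 j (by simp), ?_⟩
  intro h0
  rw [← h2, eta_mul, eta_simple, if_pos rfl,
    show cs.simple j * cs.simple j * (cs.simple j)⁻¹ = cs.simple j by simp] at h0
  have hne : eta cs (cs.wordProd ω') (cs.simple j) ≠ 0 := by
    intro h; rw [h] at h0; simp at h0
  obtain ⟨k, hk, he⟩ := erase_of_eta cs ω' _ hne
  have h4 := hmin (ω'.eraseIdx k) (fun i hi => h1 i (by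
    simp [List.mem_of_mem_eraseIdx hi])) (by rw [← he, h2])
  rw [List.length_eraseIdx_of_lt hk] at h4
  simp at h4
  omega

lemma exists_min (J : Finset B) (w : W) : ∃ u, u⁻¹ * w ∈ parabolic cs J ∧
    ∀ t ∈ parabolic cs J, eta cs u t = 0 := by
  classical
  have hex : ∃ n, ∃ u, u⁻¹ * w ∈ parabolic cs J ∧ cs.length u = n :=
    ⟨_, w, by simp, rfl⟩
  obtain ⟨u, h1, h2⟩ := Nat.find_spec hex
  refine ⟨u, h1, fun t ht => ?_⟩
  by_contra h
  have h3 := length_lt_of_eta cs h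
  rw [h2] at h3
  refine Nat.find_min hex h3 ⟨u * t, ?_, rfl⟩
  have := (parabolic cs J).mul_mem ((parabolic cs J).inv_mem ht) h1
  simpa [mul_assoc] using this

lemma unique_min {J : Finset B} {u v : W} (hu : ∀ t ∈ parabolic cs J, eta cs u t = 0)
    (hv : InX cs J v) (h : u⁻¹ * v ∈ parabolic cs J) : u = v := by
  by_contra hne
  obtain ⟨j, hj, hj2⟩ := exists_descent cs h (fun h => hne (inv_mul_eq_one.mp h))
  have h1 := (inX_iff cs).mp hv j hj
  have h2 : v = u * (u⁻¹ * v) := by simp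
  rw [h2, eta_mul, hu _ ((parabolic cs J).mul_mem ((parabolic cs J).mul_mem h
    (simple_mem_parabolic cs hj)) ((parabolic cs J).inv_mem h)), add_zero] at h1
  exact hj2 h1

lemma inX_iff' {J : Finset B} {u : W} : InX cs J u ↔ ∀ t ∈ parabolic cs J, eta cs u t = 0 := by
  constructor
  · intro h
    obtain ⟨v, h1, h2⟩ := exists_min cs J u
    rwa [← unique_min cs h2 h h1]
  · intro h
    exact (inX_iff cs).mpr fun i hi => h _ (simple_mem_parabolic cs hi)

/-- The minimal representative of `w W_J`. -/
noncomputable def rep (J : Finset B) (w : W) : W := (exists_min cs J w).choose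

lemma rep_mem (J : Finset B) (w : W) : (rep cs J w)⁻¹ * w ∈ parabolic cs J :=
  (exists_min cs J w).choose_spec.1

lemma rep_inX (J : Finset B) (w : W) : InX cs J (rep cs J w) :=
  (inX_iff' cs).mpr (exists_min cs J w).choose_spec.2

lemma rep_eq {J : Finset B} {u w : W} (hu : InX cs J u) (h : u⁻¹ * w ∈ parabolic cs J) :
    rep cs J w = u := by
  apply unique_min cs (exists_min cs J w).choose_spec.2 hu
  have := (parabolic cs J).mul_mem (rep_mem cs J w) ((parabolic cs J).inv_mem h)
  have h2 : (rep cs J w)⁻¹ * u ∈ parabolic cs J := by simpa [mul_assoc] using this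
  exact h2

open Classical in
/-- `{i ∈ I : d s_i d⁻¹ ∈ W_J}`. -/
noncomputable def meetK (J I : Finset B) (d : W) : Finset B :=
  I.filter fun i => d * cs.simple i * d⁻¹ ∈ parabolic cs J

lemma mem_meetK {J I : Finset B} {d : W} {i : B} :
    i ∈ meetK cs J I d ↔ i ∈ I ∧ d * cs.simple i * d⁻¹ ∈ parabolic cs J := by
  simp [meetK]

/-- `p d ∈ X_I` iff `u p d ∈ X_K`. -/
lemma inX_key {J I : Finset B} {d p u : W} (hdI : InX cs I d)
    (hp : p ∈ parabolic cs J) (hu : InX cs J u) :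
    InX cs I (p * d) ↔ InX cs (meetK cs J I d) (u * p * d) := by
  rw [inX_iff] at hdI
  rw [inX_iff] 
  rw [inX_iff]
  rw [inX_iff'] at hu
  have h1 : ∀ i ∈ meetK cs J I d, eta cs (u * p * d) (cs.simple i) =
      eta cs (p * d) (cs.simple i) := by
    intro i hi
    rw [mem_meetK] at hi
    rw [eta_mul, eta_mul cs p d, eta_mul cs u p, hu, add_zero]
    exact (parabolic cs J).mul_mem ((parabolic cs J).mul_mem hp hi.2)
      ((parabolic cs J).inv_mem hp)
  constructor
  · intro h i hi
    rw [h1 i hi]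
    exact h i ((mem_meetK cs).mp hi).1
  · intro h i hi
    by_cases hK : i ∈ meetK cs J I d
    · rw [← h1 i hK]; exact h i hK
    · rw [eta_mul, hdI i hi, zero_add]
      by_contra h2
      exact hK ((mem_meetK cs).mpr ⟨hi, mem_parabolic_of_eta cs hp _ h2⟩)

lemma inX_right {J I : Finset B} {d p : W} (hdJ : InX cs J d⁻¹)
    (hp : p ∈ parabolic cs J) (h : InX cs I (p * d)) : InX cs I d := by
  rw [inX_iff] at h ⊢
  rw [inX_iff'] at hdJ
  intro i hi
  have h1 := h i hi
  rw [eta_mul] at h1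
  by_contra h2
  have h3 : eta cs p (d * cs.simple i * d⁻¹) ≠ 0 := by
    intro h3; rw [h3, add_zero] at h1; exact h2 h1
  have h4 := mem_parabolic_of_eta cs hp _ h3
  have h5 := hdJ _ h4
  rw [eta_inv] at h5
  exact h2 (by simpa [mul_assoc] using h5)

open Classical in
lemma descentBasis_eq (I : Finset B) :
    descentBasis cs I = ∑ w ∈ Finset.univ.filter (InX cs I), MonoidAlgebra.single w (1 : ℚ) := by
  rw [Finset.sum_filter]
  unfold descentBasis InX
  exact Finset.sum_congr rfl fun w _ => by congr

open Classical in
/-- The set `X_{JI}` of minimal double coset representatives. -/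
noncomputable def dbl (J I : Finset B) : Finset W :=
  Finset.univ.filter fun d => InX cs J d⁻¹ ∧ InX cs I d

lemma mem_dbl {J I : Finset B} {d : W} : d ∈ dbl cs J I ↔ InX cs J d⁻¹ ∧ InX cs I d := by
  simp [dbl]

/-- Solomon's theorem. -/
theorem solomon (J I : Finset B) :
    descentBasis cs J * descentBasis cs I =
      ∑ d ∈ dbl cs J I, descentBasis cs (meetK cs J I d) := by
  classical
  simp only [descentBasis_eq]
  rw [Finset.sum_mul_sum, ← Finset.sum_product', Finset.sum_sigma']
  have hd : ∀ v : W, v * rep cs J v⁻¹ ∈ parabolic cs J := fun v => by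
    simpa using (parabolic cs J).inv_mem (rep_mem cs J v⁻¹)
  refine Finset.sum_bij' (fun q _ => ⟨(rep cs J q.2⁻¹)⁻¹, q.1 * q.2⟩)
    (fun q _ => (rep cs J (q.2 * q.1⁻¹), (rep cs J (q.2 * q.1⁻¹))⁻¹ * q.2)) ?_ ?_ ?_ ?_ ?_
  · rintro ⟨u, v⟩ h
    simp only [Finset.mem_product, Finset.mem_filter, Finset.mem_univ, true_and] at h
    simp only [Finset.mem_sigma, Finset.mem_filter, Finset.mem_univ, true_and, mem_dbl]
    have hv : v = (v * rep cs J v⁻¹) * (rep cs J v⁻¹)⁻¹ := by simp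
    have hX : InX cs J (rep cs J v⁻¹)⁻¹⁻¹ := by
      rw [inv_inv]; exact rep_inX cs J v⁻¹
    have hI : InX cs I (rep cs J v⁻¹)⁻¹ := inX_right cs hX (hd v) (by rw [← hv]; exact h.2)
    refine ⟨⟨hX, hI⟩, ?_⟩
    have := (inX_key cs hI (hd v) h.1).mp (by rw [← hv]; exact h.2)
    rwa [mul_assoc, ← hv] at this
  · rintro ⟨d, w⟩ h
    simp only [Finset.mem_sigma, Finset.mem_filter, Finset.mem_univ, true_and, mem_dbl] at h
    simp only [Finset.mem_product, Finset.mem_filter, Finset.mem_univ, true_and]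
    refine ⟨rep_inX cs J _, ?_⟩
    have := (inX_key cs h.1.2 (rep_mem cs J (w * d⁻¹)) (rep_inX cs J (w * d⁻¹))).mpr
      (by simpa [mul_assoc] using h.2)
    simpa [mul_assoc] using this
  · rintro ⟨u, v⟩ h
    simp only [Finset.mem_product, Finset.mem_filter, Finset.mem_univ, true_and] at h
    have : rep cs J (u * v * (rep cs J v⁻¹)⁻¹⁻¹) = u :=
      rep_eq cs h.1 (by simpa [mul_assoc] using hd v)
    simp only [this]
    simp
  · rintro ⟨d, w⟩ h
    simp only [Finset.mem_sigma, Finset.mem_filter, Finset.mem_univ, true_and, mem_dbl] at h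
    have : rep cs J ((rep cs J (w * d⁻¹))⁻¹ * w)⁻¹ = d⁻¹ := by
      refine rep_eq cs h.1.1 ?_
      have := (parabolic cs J).inv_mem (rep_mem cs J (w * d⁻¹))
      simpa [mul_assoc] using this
    simp only [this]
    simp
  · rintro ⟨u, v⟩ h
    simp [MonoidAlgebra.single_mul_single]

lemma parabolic_mono {K I : Finset B} (h : K ⊆ I) : parabolic cs K ≤ parabolic cs I :=
  Subgroup.closure_mono (Set.image_mono (by exact_mod_cast h))

lemma meetK_subset (J I : Finset B) (d : W) : meetK cs J I d ⊆ I :=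
  fun _ hi => ((mem_meetK cs).mp hi).1

lemma subConj_meetK (J I : Finset B) (d : W) : subConj cs (meetK cs J I d) J := by
  refine ⟨d, fun u hu => ?_⟩
  have h : parabolic cs (meetK cs J I d) ≤
      (parabolic cs J).comap (MulAut.conj d).toMonoidHom := by
    refine (Subgroup.closure_le _).mpr ?_
    rintro _ ⟨i, hi, rfl⟩
    exact ((mem_meetK cs).mp (by exact_mod_cast hi)).2
  exact h hu

lemma subConj_of_subset {K I : Finset B} (h : K ⊆ I) : subConj cs K I :=
  ⟨1, fun u hu => by simpa using parabolic_mono cs h hu⟩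

lemma subConj_mono {K I J : Finset B} (h : K ⊆ I) (hI : subConj cs I J) : subConj cs K J := by
  obtain ⟨w, hw⟩ := hI
  exact ⟨w, fun u hu => hw u (parabolic_mono cs h hu)⟩

/-- If `W_I` is subconjugate to `W_J` then some double coset representative realises it. -/
lemma exists_dbl {I J : Finset B} (h : subConj cs I J) :
    ∃ d ∈ dbl cs J I, meetK cs J I d = I := by
  obtain ⟨w, hw⟩ := h
  -- first the minimal representative `v` of `w W_I`, then that of `W_J v`
  let v := rep cs I w
  let d := (rep cs J v⁻¹)⁻¹
  have hJ : InX cs J d⁻¹ := by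
    simp only [d, inv_inv]; exact rep_inX cs J v⁻¹
  have hp : v * d⁻¹ ∈ parabolic cs J := by
    simpa [d] using (parabolic cs J).inv_mem (rep_mem cs J v⁻¹)
  have hI : InX cs I d := inX_right cs hJ hp (by simpa using rep_inX cs I w)
  refine ⟨d, (mem_dbl cs).mpr ⟨hJ, hI⟩, (meetK_subset cs J I d).antisymm fun i hi => ?_⟩
  refine (mem_meetK cs).mpr ⟨hi, ?_⟩
  have hq := rep_mem cs I w
  have h1 := hw _ ((parabolic cs I).mul_mem ((parabolic cs I).mul_mem
    ((parabolic cs I).inv_mem hq) (simple_mem_parabolic cs hi)) hq)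
  have h2 := (parabolic cs J).mul_mem ((parabolic cs J).mul_mem
    ((parabolic cs J).inv_mem hp) h1) hp
  simpa [v, mul_assoc] using h2

end Cocycle

set_option synthInstance.maxHeartbeats 1000000 in
set_option maxHeartbeats 1000000 in
/-- For a nonnegative element `a = Σ_I c_I x_I` (all `c_I ≥ 0`) of the descent algebra,
the right ideal `aΣ(W)` equals `Σ_{F_eq(a)}(W)`, the span of the `x_I` for `I` in
`F_eq(a) = {I : ∃ J, c_J ≠ 0 and λ(I) ⊆ λ(J)}`; in particular `Σ(W)a ⊆ aΣ(W)`. -/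
theorem pos_element_right_ideal {M : CoxeterMatrix B}
    (cs : CoxeterSystem M W) (A : Subalgebra ℚ (MonoidAlgebra ℚ W))
    (hA : IsDescentAlgebra cs A) (a : MonoidAlgebra ℚ W) (c : Finset B → ℚ)
    (hc : ∀ I, 0 ≤ c I) (ha : a = ∑ I : Finset B, c I • descentBasis cs I) :
    {x : MonoidAlgebra ℚ W | ∃ b ∈ A, x = a * b} =
      (Submodule.span ℚ (descentBasis cs ''
        {I : Finset B | ∃ J : Finset B, c J ≠ 0 ∧ subConj cs I J}) :
          Submodule ℚ (MonoidAlgebra ℚ W)) ∧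
    ∀ x ∈ A, ∃ b ∈ A, x * a = a * b := by
  classical
  set F : Set (Finset B) := {I : Finset B | ∃ J : Finset B, c J ≠ 0 ∧ subConj cs I J} with hF
  have hmemA : ∀ x, x ∈ A ↔ x ∈ Submodule.span ℚ (Set.range (descentBasis cs)) := by
    intro x
    have : x ∈ (A : Set (MonoidAlgebra ℚ W)) ↔
      x ∈ (Submodule.span ℚ (Set.range (descentBasis cs)) : Set (MonoidAlgebra ℚ W)) := by
      unfold IsDescentAlgebra at hA
      rw [hA]
    exact this
  have hxA : ∀ I, descentBasis cs I ∈ A := fun I =>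
    (hmemA _).mpr (Submodule.subset_span ⟨I, rfl⟩)
  have haI : ∀ I, a * descentBasis cs I = ∑ J : Finset B, ∑ d ∈ dbl cs J I,
      c J • descentBasis cs (meetK cs J I d) := by
    intro I
    rw [ha, Finset.sum_mul]
    refine Finset.sum_congr rfl fun J _ => ?_
    rw [smul_mul_assoc, solomon, Finset.smul_sum]
  let N : Submodule ℚ (MonoidAlgebra ℚ W) :=
    (Subalgebra.toSubmodule A).map (LinearMap.mulLeft ℚ a)
  have hN : ∀ x, x ∈ N ↔ ∃ b ∈ A, x = a * b := by
    intro x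
    simp only [N, Submodule.mem_map, Subalgebra.mem_toSubmodule, LinearMap.mulLeft_apply]
    exact ⟨fun ⟨b, hb, h⟩ => ⟨b, hb, h.symm⟩, fun ⟨b, hb, h⟩ => ⟨b, hb, h.symm⟩⟩
  have hle1 : ∀ b ∈ A, a * b ∈ Submodule.span ℚ (descentBasis cs '' F) := by
    intro b hb
    have h : Submodule.span ℚ (Set.range (descentBasis cs)) ≤
        (Submodule.span ℚ (descentBasis cs '' F)).comap (LinearMap.mulLeft ℚ a) := by
      refine Submodule.span_le.mpr ?_
      rintro _ ⟨I, rfl⟩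
      simp only [SetLike.mem_coe, Submodule.mem_comap, LinearMap.mulLeft_apply]
      rw [haI]
      refine Submodule.sum_mem _ fun J _ => Submodule.sum_mem _ fun d _ => ?_
      by_cases hJ : c J = 0
      · simp [hJ]
      · exact Submodule.smul_mem _ _ (Submodule.subset_span
          ⟨_, ⟨J, hJ, subConj_meetK cs J I d⟩, rfl⟩)
    exact h ((hmemA b).mp hb)
  have hle2 : Submodule.span ℚ (descentBasis cs '' F) ≤ N := by
    refine Submodule.span_le.mpr ?_
    rintro _ ⟨I, hI, rfl⟩
    induction I using Finset.strongInduction with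
    | H I ih =>
    have hsplit : a * descentBasis cs I =
        (∑ J : Finset B, ∑ d ∈ dbl cs J I, if meetK cs J I d = I then c J else 0) •
          descentBasis cs I +
        ∑ J : Finset B, ∑ d ∈ dbl cs J I, if meetK cs J I d = I then 0 else
          c J • descentBasis cs (meetK cs J I d) := by
      rw [haI, Finset.sum_smul, ← Finset.sum_add_distrib]
      refine Finset.sum_congr rfl fun J _ => ?_
      rw [Finset.sum_smul, ← Finset.sum_add_distrib]
      refine Finset.sum_congr rfl fun d _ => ?_
      split_ifs with h
      · rw [h, add_zero]
      · rw [zero_smul, zero_add]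
    have hrest : (∑ J : Finset B, ∑ d ∈ dbl cs J I, if meetK cs J I d = I then 0 else
          c J • descentBasis cs (meetK cs J I d)) ∈ N := by
      refine Submodule.sum_mem _ fun J _ => Submodule.sum_mem _ fun d _ => ?_
      split_ifs with h
      · exact N.zero_mem
      · by_cases hJ : c J = 0
        · simp [hJ]
        · exact Submodule.smul_mem _ _ (ih _ ((meetK_subset cs J I d).ssubset_of_ne h)
            ⟨J, hJ, subConj_meetK cs J I d⟩)
    have hpos : 0 < ∑ J : Finset B, ∑ d ∈ dbl cs J I, if meetK cs J I d = I then c J else 0 := by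
      obtain ⟨J, hJ, hIJ⟩ := hI
      obtain ⟨d, hd, hdI⟩ := exists_dbl cs hIJ
      have hnn : ∀ J d, 0 ≤ if meetK cs J I d = I then c J else 0 := by
        intro J d
        split_ifs
        · exact hc J
        · exact le_rfl
      refine Finset.sum_pos' (fun J _ => Finset.sum_nonneg fun d _ => hnn J d)
        ⟨J, Finset.mem_univ _, Finset.sum_pos' (fun d _ => hnn J d) ⟨d, hd, ?_⟩⟩
      rw [if_pos hdI]
      exact lt_of_le_of_ne (hc J) (Ne.symm hJ)
    have h1 : a * descentBasis cs I ∈ N := (hN _).mpr ⟨_, hxA I, rfl⟩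
    rw [hsplit] at h1
    have h2 := (Submodule.add_mem_iff_left N hrest).mp h1
    exact (Submodule.smul_mem_iff N hpos.ne').mp h2
  refine ⟨?_, ?_⟩
  · ext x
    simp only [Set.mem_ofPred_eq, SetLike.mem_coe]
    constructor
    · rintro ⟨b, hb, rfl⟩
      exact hle1 b hb
    · intro hx
      exact (hN x).mp (hle2 hx)
  · intro x hx
    refine (hN _).mp (hle2 ?_)
    have h : Submodule.span ℚ (Set.range (descentBasis cs)) ≤
        (Submodule.span ℚ (descentBasis cs '' F)).comap (LinearMap.mulRight ℚ a) := by
      refine Submodule.span_le.mpr ?_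
      rintro _ ⟨I, rfl⟩
      simp only [SetLike.mem_coe, Submodule.mem_comap, LinearMap.mulRight_apply]
      rw [ha, Finset.mul_sum]
      refine Submodule.sum_mem _ fun J _ => ?_
      by_cases hJ : c J = 0
      · simp [hJ]
      · rw [mul_smul_comm, solomon]
        exact Submodule.smul_mem _ _ (Submodule.sum_mem _ fun d _ => Submodule.subset_span
          ⟨_, ⟨J, hJ, subConj_of_subset cs (meetK_subset cs I J d)⟩, rfl⟩)
    exact h ((hmemA x).mp hx)
end
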